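/- arXiv:2105.03008 — 4 statements merged into one kernel-verified Lean document; each statement's English description precedes it below -/
import Mathlib

section
/- Let α = ({D_g}, {α_g}, {w_{g,h}}) be a twisted partial action of a groupoid 𝒢 on a ring R such that each ideal D_g (g ∈ 𝒢) is a unital ring with identity 1_g. Then α admits a globalization if and only if for each pair (g,h) ∈ 𝒢² there exists an invertible element w̃_{g,h} ∈ U(D_{r(g)}) such that w̃_{g,h}·1_g·1_{gh} = w_{g,h} and, for every t ∈ 𝒢 with (h,t) ∈ 𝒢², α_g(w̃_{h,t}·1_{g⁻¹})·w̃_{g,ht} = 1_g·w̃_{g,h}·w̃_{gh,t}. -/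
attribute [local instance] Classical.propDecidable

universe u v w

/-- An (algebraic) groupoid: a set with a partially defined associative binary
operation in which every element `g` has a left identity `tgt g` (= `r(g)`),
a right identity `src g` (= `d(g)`) and an inverse `inv g`, a product `mul g h`
being defined precisely when `comp g h`, i.e. `src g = tgt h`. -/
structure PGroupoid (G : Type u) where
  mul : G → G → G
  inv : G → G
  src : G → G
  tgt : G → G
  comp : G → G → Prop
  comp_iff : ∀ g h, comp g h ↔ src g = tgt h
  mul_assoc' : ∀ g h k, comp g h → comp h k → mul (mul g h) k = mul g (mul h k)
  src_mul : ∀ g h, comp g h → src (mul g h) = src h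
  tgt_mul : ∀ g h, comp g h → tgt (mul g h) = tgt g
  comp_inv_left : ∀ g, comp (inv g) g
  comp_inv_right : ∀ g, comp g (inv g)
  inv_mul_self : ∀ g, mul (inv g) g = src g
  mul_inv_self : ∀ g, mul g (inv g) = tgt g
  src_inv : ∀ g, src (inv g) = tgt g
  tgt_inv : ∀ g, tgt (inv g) = src g
  tgt_mul_self : ∀ g, mul (tgt g) g = g
  mul_src_self : ∀ g, mul g (src g) = g
  comp_tgt_self : ∀ g, comp (tgt g) g
  comp_src_self : ∀ g, comp g (src g)
  inv_inv : ∀ g, inv (inv g) = g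
  inv_mul_rev : ∀ g h, comp g h → inv (mul g h) = mul (inv h) (inv g)

/-- The identities of the groupoid. -/
def PGroupoid.isId {G : Type u} (gd : PGroupoid G) (e : G) : Prop := gd.tgt e = e

/-- The additive subgroup generated by products `x * y` with `x ∈ X`, `y ∈ Y`,
i.e. the product `X · Y` of two ideals. -/
def setMulAdd {R : Type v} [NonUnitalRing R] (X Y : Set R) : AddSubgroup R :=
  AddSubgroup.closure {r | ∃ x ∈ X, ∃ y ∈ Y, r = x * y}

/-- A twisted partial action of a groupoid on a (non-necessarily unital) ring `R`:
ideals `D g` (each `D (tgt g)` an ideal of `R`, and `D g` an ideal of `D (tgt g)`),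
ring isomorphisms `act g : D (inv g) → D g` (with inverse `actinv g`), and invertible
multipliers `w g h` of `D g · D (gh)` (represented by elements acting by left/right
multiplication, with inverse multiplier `winv g h`), subject to axioms (i)-(vi). -/
structure RingTPA {G : Type u} (gd : PGroupoid G) (R : Type v) [NonUnitalRing R] where
  D : G → AddSubgroup R
  act : G → R → R
  actinv : G → R → R
  w : G → G → R
  winv : G → G → R
  ideal_top : ∀ (g : G) (r : R), ∀ x ∈ D (gd.tgt g),
      r * x ∈ D (gd.tgt g) ∧ x * r ∈ D (gd.tgt g)
  sub : ∀ g, D g ≤ D (gd.tgt g)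
  ideal_in : ∀ g, ∀ a ∈ D (gd.tgt g), ∀ x ∈ D g, a * x ∈ D g ∧ x * a ∈ D g
  act_bij : ∀ g, Set.BijOn (act g) ((D (gd.inv g) : Set R)) ((D g : Set R))
  act_add : ∀ g, ∀ a ∈ D (gd.inv g), ∀ b ∈ D (gd.inv g), act g (a + b) = act g a + act g b
  act_mul : ∀ g, ∀ a ∈ D (gd.inv g), ∀ b ∈ D (gd.inv g), act g (a * b) = act g a * act g b
  actinv_mem : ∀ g, ∀ a ∈ D g, actinv g a ∈ D (gd.inv g)
  act_actinv : ∀ g, ∀ a ∈ D g, act g (actinv g a) = a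
  actinv_act : ∀ g, ∀ a ∈ D (gd.inv g), actinv g (act g a) = a
  -- (i)
  sq : ∀ g, setMulAdd ((D g : Set R)) ((D g : Set R)) = D g
  comm : ∀ g h, setMulAdd ((D g : Set R)) ((D h : Set R)) = setMulAdd ((D h : Set R)) ((D g : Set R))
  -- (ii)
  id_eq : ∀ e, gd.isId e → D e = D (gd.tgt e)
  act_id : ∀ e, gd.isId e → ∀ a ∈ D e, act e a = a
  -- (iii)
  act_ideal : ∀ g h, gd.comp g h →
      act g '' ((setMulAdd ((D (gd.inv g) : Set R)) ((D h : Set R)) : AddSubgroup R) : Set R) =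
        ((setMulAdd ((D g : Set R)) ((D (gd.mul g h) : Set R)) : AddSubgroup R) : Set R)
  -- `w g h` is an invertible multiplier of `D g · D (gh)`
  w_mul_mem : ∀ g h, gd.comp g h → ∀ x ∈ setMulAdd ((D g : Set R)) ((D (gd.mul g h) : Set R)),
      w g h * x ∈ setMulAdd ((D g : Set R)) ((D (gd.mul g h) : Set R)) ∧
      x * w g h ∈ setMulAdd ((D g : Set R)) ((D (gd.mul g h) : Set R))
  winv_mul_mem : ∀ g h, gd.comp g h → ∀ x ∈ setMulAdd ((D g : Set R)) ((D (gd.mul g h) : Set R)),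
      winv g h * x ∈ setMulAdd ((D g : Set R)) ((D (gd.mul g h) : Set R)) ∧
      x * winv g h ∈ setMulAdd ((D g : Set R)) ((D (gd.mul g h) : Set R))
  w_winv : ∀ g h, gd.comp g h → ∀ x ∈ setMulAdd ((D g : Set R)) ((D (gd.mul g h) : Set R)),
      w g h * (winv g h * x) = x ∧ winv g h * (w g h * x) = x ∧
      (x * w g h) * winv g h = x ∧ (x * winv g h) * w g h = x
  -- (iv)
  act_act : ∀ g h, gd.comp g h →
      ∀ a ∈ setMulAdd ((D (gd.inv h) : Set R)) ((D (gd.mul (gd.inv h) (gd.inv g)) : Set R)),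
      act g (act h a) = w g h * act (gd.mul g h) a * winv g h
  -- (v)
  w_id_left : ∀ g, ∀ x ∈ D g, w (gd.tgt g) g * x = x ∧ x * w (gd.tgt g) g = x
  w_id_right : ∀ g, ∀ x ∈ D g, w g (gd.src g) * x = x ∧ x * w g (gd.src g) = x
  -- (vi)
  w_cocycle : ∀ g h t, gd.comp g h → gd.comp h t →
      ∀ a ∈ setMulAdd
          ((setMulAdd ((D (gd.inv g) : Set R)) ((D h : Set R)) : AddSubgroup R) : Set R)
          ((D (gd.mul h t) : Set R)),
      act g (a * w h t) * w g (gd.mul h t) = act g a * w g h * w (gd.mul g h) t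

/-- The multiplication of the twisted crossed product `R ⋊_{α,w} 𝒢`, realized on
finitely supported functions `G →₀ R`:
`(a δ_g)(b δ_h) = α_g(α_g⁻¹(a) b) w_{g,h} δ_{gh}` when `(g,h)` is composable, `0` otherwise. -/
noncomputable def cpMul {G : Type u} {R : Type v} [NonUnitalRing R] (gd : PGroupoid G)
    (A : RingTPA gd R) (f f' : G →₀ R) : G →₀ R :=
  f.sum fun g a => f'.sum fun h b =>
    if gd.comp g h then Finsupp.single (gd.mul g h) (A.act g (A.actinv g a * b) * A.w g h) else 0

/-- A globalization (enveloping action) of a twisted partial action `A` of `gd` on `R`: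
a twisted global action `B` on a ring `S` together with ring monomorphisms
`φ e : D e → E e` (for identities `e`) satisfying conditions (i)-(v). -/
structure RingGlobalization {G : Type u} {R : Type v} [NonUnitalRing R] (gd : PGroupoid G)
    (A : RingTPA gd R) (S : Type w) [NonUnitalRing S] where
  B : RingTPA gd S
  global : ∀ g, B.D g = B.D (gd.tgt g)
  φ : G → R → S
  φ_add : ∀ e, gd.isId e → ∀ a ∈ A.D e, ∀ b ∈ A.D e, φ e (a + b) = φ e a + φ e b
  φ_mul : ∀ e, gd.isId e → ∀ a ∈ A.D e, ∀ b ∈ A.D e, φ e (a * b) = φ e a * φ e b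
  φ_inj : ∀ e, gd.isId e → Set.InjOn (φ e) ((A.D e : Set R))
  φ_mapsTo : ∀ e, gd.isId e → Set.MapsTo (φ e) ((A.D e : Set R)) ((B.D e : Set S))
  -- (i) φ_e(D_e) is an ideal of E_e
  φ_ideal : ∀ e, gd.isId e → ∀ s ∈ B.D e, ∀ x ∈ φ e '' ((A.D e : Set R)),
      s * x ∈ φ e '' ((A.D e : Set R)) ∧ x * s ∈ φ e '' ((A.D e : Set R))
  -- (ii) E_g = Σ_{r(h) = r(g)} β_h (φ_{d(h)}(D_{d(h)}))
  sum_cond : ∀ g, B.D g =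
      AddSubgroup.closure (⋃ h ∈ {h : G | gd.tgt h = gd.tgt g},
        B.act h '' (φ (gd.src h) '' ((A.D (gd.src h) : Set R))))
  -- (iii) φ_{r(g)}(D_g) = φ_{r(g)}(D_{r(g)}) ∩ β_g(φ_{d(g)}(D_{d(g)}))
  inter_cond : ∀ g, φ (gd.tgt g) '' ((A.D g : Set R)) =
      (φ (gd.tgt g) '' ((A.D (gd.tgt g) : Set R))) ∩
        (B.act g '' (φ (gd.src g) '' ((A.D (gd.src g) : Set R))))
  -- (iv) β_g ∘ φ_{d(g)} = φ_{r(g)} ∘ α_g on D_{g⁻¹}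
  equivar : ∀ g, ∀ a ∈ A.D (gd.inv g), B.act g (φ (gd.src g) a) = φ (gd.tgt g) (A.act g a)
  -- (v) φ_{r(g)} intertwines w_{g,h} and u_{g,h}
  w_cond : ∀ g h, gd.comp g h →
      ∀ a ∈ setMulAdd ((A.D g : Set R)) ((A.D (gd.mul g h) : Set R)),
      φ (gd.tgt g) (a * A.w g h) = φ (gd.tgt g) a * B.w g h ∧
      φ (gd.tgt g) (A.w g h * a) = B.w g h * φ (gd.tgt g) a


namespace PGroupoid

variable {G : Type u} (gd : PGroupoid G)

theorem src_tgt (g : G) : gd.src (gd.tgt g) = gd.tgt g :=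
  (gd.comp_iff _ _).1 (gd.comp_tgt_self g)

theorem tgt_tgt (g : G) : gd.tgt (gd.tgt g) = gd.tgt g := by
  have h := gd.tgt_mul _ _ (gd.comp_tgt_self g)
  rw [gd.tgt_mul_self] at h
  exact h.symm

theorem tgt_src (g : G) : gd.tgt (gd.src g) = gd.src g :=
  ((gd.comp_iff _ _).1 (gd.comp_src_self g)).symm

variable {gd}

theorem isId.src_eq {e : G} (he : gd.isId e) : gd.src e = e := by
  have h := gd.src_tgt e
  rwa [show gd.tgt e = e from he] at h

theorem isId.mul_left {e g : G} (he : gd.isId e) (hg : gd.comp e g) : gd.mul e g = g := by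
  have h := (gd.comp_iff _ _).1 hg
  rw [he.src_eq] at h
  rw [h, gd.tgt_mul_self]

theorem isId.mul_right {e g : G} (he : gd.isId e) (hg : gd.comp g e) : gd.mul g e = g := by
  have h := (gd.comp_iff _ _).1 hg
  rw [show gd.tgt e = e from he] at h
  rw [← h, gd.mul_src_self]

theorem comp.mul_left {g h k : G} (hgh : gd.comp g h) (hhk : gd.comp h k) :
    gd.comp (gd.mul g h) k := by
  rw [gd.comp_iff, gd.src_mul _ _ hgh, (gd.comp_iff _ _).1 hhk]

theorem comp.mul_right {g h k : G} (hgh : gd.comp g h) (hhk : gd.comp h k) :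
    gd.comp g (gd.mul h k) := by
  rw [gd.comp_iff, gd.tgt_mul _ _ hhk, (gd.comp_iff _ _).1 hgh]

theorem mul_inv_cancel_right {g h : G} (hgh : gd.comp g h) :
    gd.mul (gd.mul g h) (gd.inv h) = g := by
  rw [gd.mul_assoc' _ _ _ hgh (gd.comp_inv_right h), gd.mul_inv_self,
    ← (gd.comp_iff _ _).1 hgh, gd.mul_src_self]

theorem mul_inv_cancel_left {g h : G} (hgh : gd.tgt g = gd.tgt h) :
    gd.mul g (gd.mul (gd.inv g) h) = h := by
  rw [← gd.mul_assoc' _ _ _ (gd.comp_inv_right g)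
    ((gd.comp_iff _ _).2 (by rw [gd.src_inv, hgh])), gd.mul_inv_self, hgh, gd.tgt_mul_self]

theorem comp_inv_of_tgt_eq {g h : G} (hgh : gd.tgt g = gd.tgt h) : gd.comp (gd.inv g) h :=
  (gd.comp_iff _ _).2 (by rw [gd.src_inv, hgh])

end PGroupoid

namespace RingTPA

variable {G : Type u} {R : Type v} [NonUnitalRing R] {gd : PGroupoid G}

/-- A choice of identity elements for the ideals `D g` of a twisted partial action. -/
structure LocalUnits (A : RingTPA gd R) where
  one : G → R
  one_mem : ∀ g, one g ∈ A.D g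
  one_mul : ∀ {g x}, x ∈ A.D g → one g * x = x
  mul_one : ∀ {g x}, x ∈ A.D g → x * one g = x

variable {A : RingTPA gd R}

theorem mul_mem {g : G} {x y : R} (_ : x ∈ A.D (gd.tgt g)) (hy : y ∈ A.D (gd.tgt g)) :
    x * y ∈ A.D (gd.tgt g) :=
  (A.ideal_top g x y hy).1

theorem mul_mem_left {g : G} {x y : R} (hx : x ∈ A.D (gd.tgt g)) (hy : y ∈ A.D g) :
    x * y ∈ A.D g :=
  (A.ideal_in g x hx y hy).1

theorem mul_mem_right {g : G} {x y : R} (hx : x ∈ A.D g) (hy : y ∈ A.D (gd.tgt g)) :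
    x * y ∈ A.D g :=
  (A.ideal_in g y hy x hx).2

theorem act_mem {g : G} {x : R} (hx : x ∈ A.D (gd.inv g)) : A.act g x ∈ A.D g :=
  (A.act_bij g).mapsTo hx

theorem mem_src {g : G} {x : R} (hx : x ∈ A.D (gd.inv g)) : x ∈ A.D (gd.src g) := by
  have := A.sub _ hx
  rwa [gd.tgt_inv] at this

namespace LocalUnits

variable (U : LocalUnits A)

theorem one_mem_tgt (g : G) : U.one g ∈ A.D (gd.tgt g) := A.sub g (U.one_mem g)

theorem one_mem_inv (g : G) : U.one (gd.inv g) ∈ A.D (gd.src g) := mem_src (U.one_mem _)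

theorem comm {g : G} {x : R} (hx : x ∈ A.D (gd.tgt g)) : x * U.one g = U.one g * x := by
  have h1 := U.one_mul (mul_mem_left hx (U.one_mem g))
  have h2 := U.mul_one (mul_mem_right (U.one_mem g) hx)
  rw [← h1, ← mul_assoc, h2]

include U in
theorem mem_mulAdd_iff {g h : G} (e : gd.tgt g = gd.tgt h) {x : R} :
    x ∈ setMulAdd (A.D g : Set R) (A.D h : Set R) ↔ x ∈ A.D g ∧ x ∈ A.D h := by
  constructor
  · intro hx
    induction hx using AddSubgroup.closure_induction with
    | mem x hx =>
      obtain ⟨y, hy, z, hz, rfl⟩ := hx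
      exact ⟨mul_mem_right hy (e ▸ A.sub _ hz), mul_mem_left (e ▸ A.sub _ hy) hz⟩
    | zero => exact ⟨zero_mem _, zero_mem _⟩
    | add x y _ _ hx hy => exact ⟨add_mem hx.1 hy.1, add_mem hx.2 hy.2⟩
    | neg x _ hx => exact ⟨neg_mem hx.1, neg_mem hx.2⟩
  · rintro ⟨hg, hh⟩
    exact AddSubgroup.subset_closure ⟨x, hg, U.one h, U.one_mem h, (U.mul_one hh).symm⟩

theorem mul_one_mem {g h : G} (e : gd.tgt g = gd.tgt h) {x : R} (hx : x ∈ A.D g) :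
    x * U.one h ∈ A.D g ∧ x * U.one h ∈ A.D h :=
  ⟨mul_mem_right hx (e ▸ U.one_mem_tgt h), mul_mem_left (e ▸ A.sub _ hx) (U.one_mem h)⟩

include U in
theorem act_mem_mul {g h : G} (hgh : gd.comp g h) {x : R} (hx : x ∈ A.D (gd.inv g))
    (hx' : x ∈ A.D h) : A.act g x ∈ A.D (gd.mul g h) := by
  have e : gd.tgt (gd.inv g) = gd.tgt h := by rw [gd.tgt_inv, (gd.comp_iff _ _).1 hgh]
  have : A.act g x ∈ (setMulAdd (A.D g : Set R) (A.D (gd.mul g h) : Set R) : AddSubgroup R) := by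
    rw [← SetLike.mem_coe, ← A.act_ideal g h hgh]
    exact ⟨x, (U.mem_mulAdd_iff e).2 ⟨hx, hx'⟩, rfl⟩
  exact ((U.mem_mulAdd_iff (gd.tgt_mul _ _ hgh).symm).1 this).2

theorem act_one_mul_one {g h : G} (hgh : gd.comp g h) :
    A.act g (U.one (gd.inv g) * U.one h) = U.one g * U.one (gd.mul g h) := by
  have e : gd.tgt (gd.inv g) = gd.tgt h := by rw [gd.tgt_inv, (gd.comp_iff _ _).1 hgh]
  have e' : gd.tgt g = gd.tgt (gd.mul g h) := (gd.tgt_mul _ _ hgh).symm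
  obtain ⟨hz, hz'⟩ := U.mul_one_mem e (U.one_mem (gd.inv g))
  obtain ⟨ho, ho'⟩ := U.mul_one_mem e' (U.one_mem g)
  obtain ⟨y, hy, hy'⟩ : U.one g * U.one (gd.mul g h) ∈ A.act g ''
      ((setMulAdd (A.D (gd.inv g) : Set R) (A.D h : Set R) : AddSubgroup R) : Set R) := by
    rw [A.act_ideal g h hgh]
    exact (U.mem_mulAdd_iff e').2 ⟨ho, ho'⟩
  obtain ⟨hy1, hy2⟩ := (U.mem_mulAdd_iff e).1 hy
  have h1 : A.act g (U.one (gd.inv g) * U.one h) * (U.one g * U.one (gd.mul g h)) =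
      A.act g (U.one (gd.inv g) * U.one h) := by
    rw [← mul_assoc, U.mul_one (act_mem hz), U.mul_one (U.act_mem_mul hgh hz hz')]
  rw [← h1, ← hy', ← A.act_mul g _ hz _ hy1, mul_assoc, U.one_mul hy2, U.one_mul hy1]

theorem act_mul_one {g h : G} (hgh : gd.comp g h) {a : R} (ha : a ∈ A.D (gd.inv g)) :
    A.act g (a * U.one h) = A.act g a * U.one (gd.mul g h) := by
  have e : gd.tgt (gd.inv g) = gd.tgt h := by rw [gd.tgt_inv, (gd.comp_iff _ _).1 hgh]
  obtain ⟨hz, hz'⟩ := U.mul_one_mem e (U.one_mem (gd.inv g))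
  calc A.act g (a * U.one h) = A.act g (a * (U.one (gd.inv g) * U.one h)) := by
        rw [← mul_assoc, U.mul_one ha]
    _ = A.act g a * (U.one g * U.one (gd.mul g h)) := by
        rw [A.act_mul g _ ha _ hz, U.act_one_mul_one hgh]
    _ = _ := by rw [← mul_assoc, U.mul_one (act_mem ha)]

theorem act_one (g : G) : A.act g (U.one (gd.inv g)) = U.one g := by
  obtain ⟨y, hy, hy'⟩ := (A.act_bij g).surjOn (U.one_mem g)
  have h := U.mul_one (act_mem (U.one_mem (gd.inv g)))
  rw [← h, ← hy', ← A.act_mul g _ (U.one_mem _) _ hy, U.one_mul hy]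

end LocalUnits

end RingTPA

namespace RingGlobalization

variable {G : Type u} {R : Type v} [NonUnitalRing R] {gd : PGroupoid G} {A : RingTPA gd R}
  {S : Type w} [NonUnitalRing S] (Γ : RingGlobalization gd A S) (U : A.LocalUnits)

include Γ

theorem D_eq_of_tgt_eq {g h : G} (e : gd.tgt g = gd.tgt h) : Γ.B.D g = Γ.B.D h := by
  rw [Γ.global g, Γ.global h, e]

variable {e : G} (he : gd.isId e)

include he

theorem φ_mul_φ_one {a : R} (ha : a ∈ A.D e) : Γ.φ e a * Γ.φ e (U.one e) = Γ.φ e a := by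
  rw [← Γ.φ_mul e he _ ha _ (U.one_mem e), U.mul_one ha]

theorem φ_one_mul_φ {a : R} (ha : a ∈ A.D e) : Γ.φ e (U.one e) * Γ.φ e a = Γ.φ e a := by
  rw [← Γ.φ_mul e he _ (U.one_mem e) _ ha, U.one_mul ha]

theorem φ_one_mul_mem (s : S) : ∃ a ∈ A.D e, Γ.φ e a = Γ.φ e (U.one e) * s := by
  have hp : Γ.φ e (U.one e) * s ∈ Γ.B.D e := by
    have := (Γ.B.ideal_top e s (Γ.φ e (U.one e)) (by
      rw [show gd.tgt e = e from he]; exact Γ.φ_mapsTo e he (U.one_mem e))).2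
    rwa [show gd.tgt e = e from he] at this
  have := (Γ.φ_ideal e he _ hp _ ⟨_, U.one_mem e, rfl⟩).2
  rwa [← mul_assoc, Γ.φ_mul_φ_one U he (U.one_mem e)] at this

theorem mul_φ_one_mem (s : S) : ∃ a ∈ A.D e, Γ.φ e a = s * Γ.φ e (U.one e) := by
  have hp : s * Γ.φ e (U.one e) ∈ Γ.B.D e := by
    have := (Γ.B.ideal_top e s (Γ.φ e (U.one e)) (by
      rw [show gd.tgt e = e from he]; exact Γ.φ_mapsTo e he (U.one_mem e))).1
    rwa [show gd.tgt e = e from he] at this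
  have := (Γ.φ_ideal e he _ hp _ ⟨_, U.one_mem e, rfl⟩).1
  rwa [mul_assoc, Γ.φ_mul_φ_one U he (U.one_mem e)] at this

theorem φ_one_comm (s : S) : Γ.φ e (U.one e) * s = s * Γ.φ e (U.one e) := by
  obtain ⟨a, ha, h⟩ := Γ.φ_one_mul_mem U he s
  obtain ⟨b, hb, h'⟩ := Γ.mul_φ_one_mem U he s
  rw [← h, ← Γ.φ_mul_φ_one U he ha, h, mul_assoc, ← h', Γ.φ_one_mul_φ U he hb]

omit he

theorem exists_twist : ∃ wt : G → G → R, ∀ g h, gd.comp g h →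
    (wt g h ∈ A.D (gd.tgt g) ∧
      ∃ vt ∈ A.D (gd.tgt g),
        wt g h * vt = U.one (gd.tgt g) ∧ vt * wt g h = U.one (gd.tgt g)) ∧
    (∀ x ∈ setMulAdd ((A.D g : Set R)) ((A.D (gd.mul g h) : Set R)),
        A.w g h * x = wt g h * (U.one g * U.one (gd.mul g h)) * x ∧
        x * A.w g h = x * (wt g h * (U.one g * U.one (gd.mul g h)))) ∧
    (∀ t, gd.comp h t →
        A.act g (wt h t * U.one (gd.inv g)) * wt g (gd.mul h t) =
          U.one g * wt g h * wt (gd.mul g h) t) := by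
  choose wt wt_mem wt_eq using fun g h => Γ.φ_one_mul_mem U (gd.tgt_tgt g) (Γ.B.w g h)
  refine ⟨wt, fun g h hgh => ?_⟩
  have hid := gd.tgt_tgt g
  have htgt := gd.tgt_mul _ _ hgh
  have hinj := Γ.φ_inj (gd.tgt g) hid
  have hone := Γ.φ_mapsTo (gd.tgt g) hid (U.one_mem _)
  refine ⟨⟨wt_mem g h, ?_⟩, ?_, ?_⟩
  · obtain ⟨vt, vt_mem, vt_eq⟩ := Γ.φ_one_mul_mem U hid (Γ.B.winv g h)
    have hp : Γ.φ (gd.tgt g) (U.one (gd.tgt g)) ∈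
        setMulAdd (Γ.B.D g : Set S) (Γ.B.D (gd.mul g h) : Set S) := by
      rw [Γ.D_eq_of_tgt_eq htgt, Γ.global g]
      exact AddSubgroup.subset_closure ⟨_, hone, _, hone,
        (Γ.φ_mul_φ_one U hid (U.one_mem _)).symm⟩
    obtain ⟨-, -, h1, h2⟩ := Γ.B.w_winv g h hgh _ hp
    refine ⟨vt, vt_mem, hinj (RingTPA.mul_mem (wt_mem g h) vt_mem) (U.one_mem _) ?_,
      hinj (RingTPA.mul_mem vt_mem (wt_mem g h)) (U.one_mem _) ?_⟩
    · rw [Γ.φ_mul _ hid _ (wt_mem g h) _ vt_mem, vt_eq, ← mul_assoc,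
        Γ.φ_mul_φ_one U hid (wt_mem g h), wt_eq, h1]
    · rw [Γ.φ_mul _ hid _ vt_mem _ (wt_mem g h), wt_eq, ← mul_assoc,
        Γ.φ_mul_φ_one U hid vt_mem, vt_eq, h2]
  · intro x hx
    obtain ⟨hx1, hx2⟩ := (U.mem_mulAdd_iff htgt.symm).1 hx
    obtain ⟨hw1, hw2⟩ := A.w_mul_mem g h hgh x hx
    have hx' := A.sub _ hx1
    obtain ⟨hc1, hc2⟩ := Γ.w_cond g h hgh x hx
    have hxw : x * wt g h ∈ A.D g := RingTPA.mul_mem_right hx1 (wt_mem g h)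
    have hxw' : x * wt g h ∈ A.D (gd.mul g h) :=
      RingTPA.mul_mem_right hx2 (htgt ▸ wt_mem g h)
    constructor
    · rw [mul_assoc, mul_assoc (U.one g), U.one_mul hx2, U.one_mul hx1]
      refine hinj (A.sub _ ((U.mem_mulAdd_iff htgt.symm).1 hw1).1)
        (RingTPA.mul_mem (wt_mem g h) hx') ?_
      rw [hc2, Γ.φ_mul _ hid _ (wt_mem g h) _ hx', wt_eq, Γ.φ_one_comm U hid, mul_assoc,
        Γ.φ_one_mul_φ U hid hx']
    · rw [← mul_assoc, ← mul_assoc, U.mul_one hxw, U.mul_one hxw']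
      refine hinj (A.sub _ ((U.mem_mulAdd_iff htgt.symm).1 hw2).1)
        (RingTPA.mul_mem hx' (wt_mem g h)) ?_
      rw [hc1, Γ.φ_mul _ hid _ hx' _ (wt_mem g h), wt_eq, ← mul_assoc,
        Γ.φ_mul_φ_one U hid hx']
  · intro t hht
    have hsrc := (gd.comp_iff _ _).1 hgh
    have hids : gd.isId (gd.src g) := gd.tgt_src g
    have wt_mem' : wt h t ∈ A.D (gd.tgt (gd.inv g)) := by
      rw [gd.tgt_inv, hsrc]; exact wt_mem h t
    have wt_mem₂ : wt (gd.mul g h) t ∈ A.D (gd.tgt g) := htgt ▸ wt_mem (gd.mul g h) t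
    have wt_eq₂ : Γ.φ (gd.tgt g) (wt (gd.mul g h) t) =
        Γ.φ (gd.tgt g) (U.one (gd.tgt g)) * Γ.B.w (gd.mul g h) t := by
      have := wt_eq (gd.mul g h) t
      rwa [htgt] at this
    have wt_eq₁ : Γ.φ (gd.src g) (wt h t) =
        Γ.φ (gd.src g) (U.one (gd.src g)) * Γ.B.w h t := by
      rw [hsrc]; exact wt_eq h t
    have hq := U.one_mem_inv g
    have hqS := Γ.φ_mapsTo _ hids hq
    have hqm : wt h t * U.one (gd.inv g) ∈ A.D (gd.inv g) :=
      RingTPA.mul_mem_left wt_mem' (U.one_mem _)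
    have hcoc := Γ.B.w_cocycle g h t hgh hht (Γ.φ (gd.src g) (U.one (gd.inv g))) (by
      rw [Γ.D_eq_of_tgt_eq (gd.tgt_mul _ _ hht),
        Γ.D_eq_of_tgt_eq (show gd.tgt h = gd.tgt (gd.src g) by rw [← hsrc, gd.tgt_src]),
        Γ.D_eq_of_tgt_eq (show gd.tgt (gd.inv g) = gd.tgt (gd.src g) by
          rw [gd.tgt_inv, gd.tgt_src])]
      have hqq : Γ.φ (gd.src g) (U.one (gd.inv g)) = Γ.φ (gd.src g) (U.one (gd.inv g)) *
          Γ.φ (gd.src g) (U.one (gd.inv g)) := by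
        rw [← Γ.φ_mul _ hids _ hq _ hq, U.one_mul (U.one_mem _)]
      exact AddSubgroup.subset_closure
        ⟨_, AddSubgroup.subset_closure ⟨_, hqS, _, hqS, hqq⟩, _, hqS, hqq⟩)
    rw [Γ.equivar g _ (U.one_mem _), U.act_one] at hcoc
    have hactm := A.sub _ (RingTPA.act_mem hqm)
    have hog := U.one_mem_tgt g
    refine hinj (RingTPA.mul_mem hactm (wt_mem _ _))
      (RingTPA.mul_mem (RingTPA.mul_mem hog (wt_mem _ _)) wt_mem₂) ?_
    rw [Γ.φ_mul _ hid _ hactm _ (wt_mem _ _), wt_eq, ← mul_assoc, Γ.φ_mul_φ_one U hid hactm,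
      ← Γ.equivar g _ hqm, U.comm wt_mem', Γ.φ_mul _ hids _ hq _ (hsrc ▸ wt_mem h t), wt_eq₁,
      ← mul_assoc, Γ.φ_mul_φ_one U hids hq, hcoc,
      Γ.φ_mul _ hid _ (RingTPA.mul_mem hog (wt_mem _ _)) _ wt_mem₂, wt_eq₂, ← mul_assoc,
      Γ.φ_mul_φ_one U hid (RingTPA.mul_mem hog (wt_mem _ _)), Γ.φ_mul _ hid _ hog _ (wt_mem _ _),
      wt_eq, ← mul_assoc, Γ.φ_mul_φ_one U hid hog]

end RingGlobalization

namespace RingTPA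

variable {G : Type u} {R : Type v} [NonUnitalRing R] {gd : PGroupoid G}

/-- An extension of the twist of a partial action with local units to invertible elements
`wt g h` of `D (tgt g)` satisfying the cocycle identity and normalized at the identities. -/
structure ExtendedTwist (A : RingTPA gd R) extends LocalUnits A where
  wt : G → G → R
  vt : G → G → R
  wt_mem : ∀ g h, wt g h ∈ A.D (gd.tgt g)
  vt_mem : ∀ g h, vt g h ∈ A.D (gd.tgt g)
  wt_vt : ∀ g h, wt g h * vt g h = one (gd.tgt g)
  vt_wt : ∀ g h, vt g h * wt g h = one (gd.tgt g)
  w_mul : ∀ {g h x}, gd.comp g h → x ∈ A.D g → x ∈ A.D (gd.mul g h) → A.w g h * x = wt g h * x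
  mul_w : ∀ {g h x}, gd.comp g h → x ∈ A.D g → x ∈ A.D (gd.mul g h) → x * A.w g h = x * wt g h
  cocycle : ∀ {g h t}, gd.comp g h → gd.comp h t →
    A.act g (wt h t * one (gd.inv g)) * wt g (gd.mul h t) = one g * wt g h * wt (gd.mul g h) t
  wt_id_left : ∀ {e h}, gd.isId e → wt e h = one e
  wt_id_right : ∀ {g e}, gd.isId e → wt g e = one (gd.tgt g)

variable {A : RingTPA gd R} (U : LocalUnits A)

theorem LocalUnits.nonempty_extendedTwist (H : ∃ wt : G → G → R, ∀ g h, gd.comp g h →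
    (wt g h ∈ A.D (gd.tgt g) ∧
      ∃ vt ∈ A.D (gd.tgt g),
        wt g h * vt = U.one (gd.tgt g) ∧ vt * wt g h = U.one (gd.tgt g)) ∧
    (∀ x ∈ setMulAdd ((A.D g : Set R)) ((A.D (gd.mul g h) : Set R)),
        A.w g h * x = wt g h * (U.one g * U.one (gd.mul g h)) * x ∧
        x * A.w g h = x * (wt g h * (U.one g * U.one (gd.mul g h)))) ∧
    (∀ t, gd.comp h t →
        A.act g (wt h t * U.one (gd.inv g)) * wt g (gd.mul h t) =
          U.one g * wt g h * wt (gd.mul g h) t)) : Nonempty (ExtendedTwist A) := by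
  obtain ⟨wt, H⟩ := H
  have wt_mem : ∀ {g h}, gd.comp g h → wt g h ∈ A.D (gd.tgt g) := fun hgh => (H _ _ hgh).1.1
  have one_mul_one : ∀ g, U.one g * U.one g = U.one g := fun g => U.one_mul (U.one_mem g)
  have hw : ∀ {g h x}, gd.comp g h → x ∈ A.D g → x ∈ A.D (gd.mul g h) →
      A.w g h * x = wt g h * x ∧ x * A.w g h = x * wt g h := by
    intro g h x hgh hx1 hx2
    have htgt := gd.tgt_mul _ _ hgh
    obtain ⟨h1, h2⟩ := (H g h hgh).2.1 x ((U.mem_mulAdd_iff htgt.symm).2 ⟨hx1, hx2⟩)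
    rw [mul_assoc, mul_assoc (U.one g), U.one_mul hx2, U.one_mul hx1] at h1
    rw [← mul_assoc, ← mul_assoc, U.mul_one (mul_mem_right hx1 (wt_mem hgh)),
      U.mul_one (mul_mem_right hx2 (htgt ▸ wt_mem hgh))] at h2
    exact ⟨h1, h2⟩
  have one_mul_wt : ∀ {g h}, gd.comp g h → U.one (gd.tgt g) * wt g h = wt g h :=
    fun hgh => U.one_mul (wt_mem hgh)
  have id_right : ∀ {g e}, gd.isId e → gd.comp g e → U.one g * wt g e = U.one g := by
    intro g e he hge
    have hg : gd.src g = e := by rw [(gd.comp_iff _ _).1 hge, show gd.tgt e = e from he]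
    have h1 := (hw hge (U.one_mem g) (by rw [he.mul_right hge]; exact U.one_mem g)).2
    rw [← h1, ← hg, (A.w_id_right g _ (U.one_mem g)).2]
  have id_left : ∀ {e h}, gd.isId e → gd.comp e h → wt e h = U.one e := by
    intro e h he heh
    have hee : gd.comp e e := by rw [gd.comp_iff, he.src_eq, show gd.tgt e = e from he]
    have heq : wt e e = U.one e := by
      have h1 := id_right he hee
      have h2 := one_mul_wt hee
      rw [show gd.tgt e = e from he] at h2
      rw [← h2, h1]
    obtain ⟨⟨hm, v, hv, hv1, hv2⟩, -, -⟩ := H e h heh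
    have hc := (H e e hee).2.2 h heh
    have hinv : gd.inv e = e := by
      have h1 := he.mul_left (gd.comp_inv_right e)
      have h2 := gd.mul_inv_self e
      rw [← h1, h2, show gd.tgt e = e from he]
    rw [show gd.tgt e = e from he] at hm hv hv1 hv2
    rw [hinv, U.mul_one hm, A.act_id e he _ hm, he.mul_left heh, he.mul_left hee, heq,
      one_mul_one, U.one_mul hm] at hc
    have := congrArg (· * v) hc
    simp only [mul_assoc, hv1] at this
    rwa [U.mul_one hm] at this
  have hex : ∀ g h, ∃ p : R × R,
      (p.1 ∈ A.D (gd.tgt g) ∧ p.2 ∈ A.D (gd.tgt g) ∧ p.1 * p.2 = U.one (gd.tgt g) ∧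
        p.2 * p.1 = U.one (gd.tgt g)) ∧
      (gd.comp g h ∧ ¬ gd.isId h → p.1 = wt g h) ∧
      (¬ (gd.comp g h ∧ ¬ gd.isId h) → p.1 = U.one (gd.tgt g)) := by
    intro g h
    by_cases hgh : gd.comp g h ∧ ¬ gd.isId h
    · obtain ⟨⟨hm, v, hv, hv1, hv2⟩, -, -⟩ := H g h hgh.1
      exact ⟨(wt g h, v), ⟨hm, hv, hv1, hv2⟩, fun _ => rfl, fun h => absurd hgh h⟩
    · exact ⟨(U.one (gd.tgt g), U.one (gd.tgt g)),
        ⟨U.one_mem _, U.one_mem _, one_mul_one _, one_mul_one _⟩,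
        fun h => absurd h hgh, fun _ => rfl⟩
  choose p hp hp1 hp2 using hex
  have hpid : ∀ {g e}, gd.isId e → (p g e).1 = U.one (gd.tgt g) :=
    fun he => hp2 _ _ fun h => h.2 he
  have hpw : ∀ {g h}, gd.comp g h → ∀ {x}, x ∈ A.D g →
      (p g h).1 * x = wt g h * x ∧ x * (p g h).1 = x * wt g h := by
    intro g h hgh x hx
    by_cases hh : gd.isId h
    · have h1 := id_right hh hgh
      have h2 := U.comm (wt_mem hgh)
      rw [hpid hh, U.one_mul (A.sub _ hx), U.mul_one (A.sub _ hx)]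
      constructor
      · rw [← U.one_mul hx, ← mul_assoc, h2, h1]
      · rw [← U.mul_one hx, mul_assoc, h1]
    · rw [hp1 g h ⟨hgh, hh⟩]
      exact ⟨rfl, rfl⟩
  refine ⟨{ U with
    wt := fun g h => (p g h).1
    vt := fun g h => (p g h).2
    wt_mem := fun g h => (hp g h).1
    vt_mem := fun g h => (hp g h).2.1
    wt_vt := fun g h => (hp g h).2.2.1
    vt_wt := fun g h => (hp g h).2.2.2
    w_mul := fun hgh h1 h2 => ((hw hgh h1 h2).1.trans (hpw hgh h1).1.symm)
    mul_w := fun hgh h1 h2 => ((hw hgh h1 h2).2.trans (hpw hgh h1).2.symm)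
    cocycle := ?_
    wt_id_left := ?_
    wt_id_right := hpid }⟩
  · intro g h t hgh hht
    have hgt := (gd.comp_iff _ _).1 hgh
    have hmem : (p h t).1 * U.one (gd.inv g) ∈ A.D (gd.inv g) := by
      refine mul_mem_left ?_ (U.one_mem _)
      rw [gd.tgt_inv, hgt]
      exact (hp h t).1
    have hgh_mem : U.one g * (p g h).1 ∈ A.D g := mul_mem_right (U.one_mem g) (hp g h).1
    rw [(hpw (hgh.mul_right hht) (act_mem hmem)).2]
    by_cases ht : gd.isId t
    · rw [ht.mul_right hht, hpid ht, hpid ht, gd.tgt_mul _ _ hgh, U.mul_one (A.sub _ hgh_mem),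
        (hpw hgh (U.one_mem g)).2, ← hgt]
      have := U.one_mem_inv g
      rw [← gd.tgt_src] at this
      rw [← gd.tgt_src g, U.one_mul this, U.act_one]
    · rw [hp1 h t ⟨hht, ht⟩, hp1 _ t ⟨hgh.mul_left hht, ht⟩, (hpw hgh (U.one_mem g)).2]
      exact (H g h hgh).2.2 t hht
  · intro e h he
    by_cases heh : gd.comp e h ∧ ¬ gd.isId h
    · exact (hp1 e h heh).trans (id_left he heh.1)
    · rw [hp2 e h heh, show gd.tgt e = e from he]

end RingTPA

namespace RingTPA.ExtendedTwist

variable {G : Type u} {R : Type v} [NonUnitalRing R] {gd : PGroupoid G} {A : RingTPA gd R}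
  (T : ExtendedTwist A)

theorem one_mul_one (g : G) : T.one g * T.one g = T.one g := T.one_mul (T.one_mem g)

theorem mul_winv {g h : G} (hgh : gd.comp g h) {x : R} (hx : x ∈ A.D g)
    (hx' : x ∈ A.D (gd.mul g h)) : x * A.winv g h = x * T.vt g h := by
  have htgt := gd.tgt_mul _ _ hgh
  have hy : x * T.vt g h ∈ A.D g := mul_mem_right hx (T.vt_mem g h)
  have hy' : x * T.vt g h ∈ A.D (gd.mul g h) := mul_mem_right hx' (htgt ▸ T.vt_mem g h)
  have h1 := (A.w_winv g h hgh _ ((T.mem_mulAdd_iff htgt.symm).2 ⟨hy, hy'⟩)).2.2.1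
  rwa [T.mul_w hgh hy hy', mul_assoc x, T.vt_wt, T.mul_one (A.sub _ hx)] at h1

theorem act_act_mul_one {k g : G} (hkg : gd.comp k g) {a : R} (ha : a ∈ A.D (gd.inv g)) :
    A.act k (A.act g a * T.one (gd.inv k)) =
      T.wt k g * A.act (gd.mul k g) (a * T.one (gd.inv (gd.mul k g))) * T.vt k g := by
  have hinv := gd.inv_mul_rev _ _ hkg
  have hc : gd.comp (gd.inv g) (gd.inv k) := by
    rw [gd.comp_iff, gd.src_inv, gd.tgt_inv, (gd.comp_iff _ _).1 hkg]
  have hc' : gd.comp g (gd.mul (gd.inv g) (gd.inv k)) := (gd.comp_inv_right g).mul_right hc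
  have htgt : gd.tgt (gd.inv g) = gd.tgt (gd.mul (gd.inv g) (gd.inv k)) :=
    (gd.tgt_mul _ _ hc).symm
  have hmul : gd.mul g (gd.mul (gd.inv g) (gd.inv k)) = gd.inv k :=
    PGroupoid.mul_inv_cancel_left (by rw [gd.tgt_inv, (gd.comp_iff _ _).1 hkg])
  obtain ⟨h1, h2⟩ := T.mul_one_mem htgt ha
  have h3 : A.act g a * T.one (gd.inv k) =
      A.act g (a * T.one (gd.mul (gd.inv g) (gd.inv k))) := by
    rw [T.act_mul_one hc' ha, hmul]
  rw [h3, A.act_act k g hkg _ ((T.mem_mulAdd_iff htgt).2 ⟨h1, h2⟩), hinv]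
  have hy : A.act (gd.mul k g) (a * T.one (gd.mul (gd.inv g) (gd.inv k))) ∈
      A.D (gd.mul k g) := act_mem (by rwa [hinv])
  have hy' : A.act (gd.mul k g) (a * T.one (gd.mul (gd.inv g) (gd.inv k))) ∈ A.D k := by
    have := T.act_mem_mul (hkg.mul_left (gd.comp_inv_right g)) (by rwa [hinv]) h1
    rwa [PGroupoid.mul_inv_cancel_right hkg] at this
  rw [T.w_mul hkg hy' hy, T.mul_winv hkg (mul_mem_left (T.wt_mem k g) hy')
    (mul_mem_left ((gd.tgt_mul _ _ hkg).symm ▸ T.wt_mem k g) hy)]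

theorem act_mul_act {k g : G} (hkg : gd.comp k g) {a b : R} (ha : a ∈ A.D (gd.inv k))
    (hb : b ∈ A.D (gd.src g)) :
    A.act k (a * A.act g (b * T.one (gd.inv g))) =
        A.act k a *
          (T.wt k g * A.act (gd.mul k g) (b * T.one (gd.inv (gd.mul k g))) * T.vt k g) ∧
      A.act k (A.act g (b * T.one (gd.inv g)) * a) =
        (T.wt k g * A.act (gd.mul k g) (b * T.one (gd.inv (gd.mul k g))) * T.vt k g) *
          A.act k a := by
  have hb' : b ∈ A.D (gd.tgt (gd.inv g)) := by rwa [gd.tgt_inv]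
  have hb'' : b ∈ A.D (gd.tgt (gd.inv (gd.mul k g))) := by
    rwa [gd.tgt_inv, gd.src_mul _ _ hkg]
  have hbg : b * T.one (gd.inv g) ∈ A.D (gd.inv g) := mul_mem_left hb' (T.one_mem _)
  have hbkg : b * T.one (gd.inv (gd.mul k g)) ∈ A.D (gd.inv (gd.mul k g)) :=
    mul_mem_left hb'' (T.one_mem _)
  have htk : gd.tgt (gd.inv k) = gd.tgt g := by rw [gd.tgt_inv, (gd.comp_iff _ _).1 hkg]
  have hc : A.act g (b * T.one (gd.inv g)) ∈ A.D (gd.tgt (gd.inv k)) := by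
    rw [htk]; exact A.sub _ (act_mem hbg)
  have hcm : A.act g (b * T.one (gd.inv g)) * T.one (gd.inv k) ∈ A.D (gd.inv k) :=
    mul_mem_left hc (T.one_mem _)
  have hone : T.one (gd.inv (gd.mul k g)) ∈ A.D (gd.tgt (gd.inv g)) := by
    have := T.one_mem_inv (gd.mul k g)
    rwa [gd.src_mul _ _ hkg, ← gd.tgt_inv] at this
  have hswap : b * T.one (gd.inv g) * T.one (gd.inv (gd.mul k g)) =
      b * T.one (gd.inv (gd.mul k g)) * T.one (gd.inv g) := by
    rw [mul_assoc, mul_assoc, T.comm hone]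
  have hkey : A.act k (A.act g (b * T.one (gd.inv g)) * T.one (gd.inv k)) =
      T.wt k g * A.act (gd.mul k g) (b * T.one (gd.inv (gd.mul k g))) * T.vt k g * T.one k := by
    rw [T.act_act_mul_one hkg hbg, hswap,
      T.act_mul_one (hkg.mul_left (gd.comp_inv_right g)) hbkg,
      PGroupoid.mul_inv_cancel_right hkg, mul_assoc, mul_assoc, ← T.comm (T.vt_mem k g)]
    simp only [mul_assoc]
  have hD : T.wt k g * A.act (gd.mul k g) (b * T.one (gd.inv (gd.mul k g))) * T.vt k g ∈
      A.D (gd.tgt k) := by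
    refine mul_mem (mul_mem (T.wt_mem k g) ?_) (T.vt_mem k g)
    rw [← gd.tgt_mul _ _ hkg]
    exact A.sub _ (act_mem hbkg)
  constructor
  · have : a * A.act g (b * T.one (gd.inv g)) =
        a * (A.act g (b * T.one (gd.inv g)) * T.one (gd.inv k)) := by
      rw [← mul_assoc, T.mul_one (mul_mem_right ha hc)]
    rw [this, A.act_mul k _ ha _ hcm, hkey, T.comm hD, ← mul_assoc, T.mul_one (act_mem ha)]
  · have : A.act g (b * T.one (gd.inv g)) * a =
        (A.act g (b * T.one (gd.inv g)) * T.one (gd.inv k)) * a := by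
      rw [mul_assoc, T.one_mul ha]
    rw [this, A.act_mul k _ hcm _ ha, hkey, mul_assoc _ (T.one k), T.one_mul (act_mem ha)]

theorem act_mul_wt {k g h : G} (hkg : gd.comp k g) (hgh : gd.comp g h) {a : R}
    (ha : a ∈ A.D (gd.inv k)) :
    A.act k (a * T.wt g h) =
        A.act k a * (T.wt k g * T.wt (gd.mul k g) h * T.vt k (gd.mul g h)) ∧
      A.act k (T.wt g h * a) =
        (T.wt k g * T.wt (gd.mul k g) h * T.vt k (gd.mul g h)) * A.act k a := by
  have htk : gd.tgt (gd.inv k) = gd.tgt g := by rw [gd.tgt_inv, (gd.comp_iff _ _).1 hkg]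
  have hwt : T.wt g h ∈ A.D (gd.tgt (gd.inv k)) := htk ▸ T.wt_mem g h
  have hwm : T.wt g h * T.one (gd.inv k) ∈ A.D (gd.inv k) := mul_mem_left hwt (T.one_mem _)
  have hD : T.wt k g * T.wt (gd.mul k g) h * T.vt k (gd.mul g h) ∈ A.D (gd.tgt k) :=
    mul_mem (mul_mem (T.wt_mem k g) (gd.tgt_mul _ _ hkg ▸ T.wt_mem _ _)) (T.vt_mem _ _)
  have hkey : A.act k (T.wt g h * T.one (gd.inv k)) =
      T.one k * (T.wt k g * T.wt (gd.mul k g) h * T.vt k (gd.mul g h)) := by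
    have := congrArg (· * T.vt k (gd.mul g h)) (T.cocycle hkg hgh)
    simp only [mul_assoc, T.wt_vt] at this
    rw [T.mul_one (A.sub _ (act_mem hwm))] at this
    rw [this]
    simp only [mul_assoc]
  constructor
  · have : a * T.wt g h = a * (T.wt g h * T.one (gd.inv k)) := by
      rw [← mul_assoc, T.mul_one (mul_mem_right ha hwt)]
    rw [this, A.act_mul k _ ha _ hwm, hkey, ← mul_assoc, T.mul_one (act_mem ha)]
  · have : T.wt g h * a = T.wt g h * T.one (gd.inv k) * a := by
      rw [mul_assoc, T.one_mul ha]
    rw [this, A.act_mul k _ hwm _ ha, hkey, ← T.comm hD, mul_assoc _ (T.one k),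
      T.one_mul (act_mem ha)]

end RingTPA.ExtendedTwist

namespace RingTPA.ExtendedTwist

variable {G : Type u} {R : Type v} [NonUnitalRing R] {gd : PGroupoid G} {A : RingTPA gd R}

/-- The functions on the groupoid whose value at `k` lies in `D (tgt k)`. -/
def funSubring (_ : ExtendedTwist A) : NonUnitalSubring (G → R) where
  carrier := {f | ∀ k, f k ∈ A.D (gd.tgt k)}
  add_mem' hf hg k := add_mem (hf k) (hg k)
  zero_mem' _ := zero_mem _
  neg_mem' hf k := neg_mem (hf k)
  mul_mem' hf hg k := mul_mem (hf k) (hg k)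

/-- The unital ring of functions on the groupoid whose value at `k` lies in `D (tgt k)`. -/
def Fun (T : ExtendedTwist A) : Type (max u v) := T.funSubring

variable (T : ExtendedTwist A)

noncomputable instance : Ring T.Fun :=
  { (inferInstance : NonUnitalRing T.funSubring) with
    one := ⟨fun k => T.one (gd.tgt k), fun k => T.one_mem _⟩
    one_mul := fun f => Subtype.ext (funext fun k => T.one_mul (f.2 k))
    mul_one := fun f => Subtype.ext (funext fun k => T.mul_one (f.2 k)) }

variable {T}

/-- A function whose value at `k` lies in `D (tgt k)`, as an element of the ring `Fun`. -/
def Fun.of (f : G → R) (h : ∀ k, f k ∈ A.D (gd.tgt k)) : T.Fun := ⟨f, h⟩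

@[simp] theorem Fun.of_apply (f : G → R) (h : ∀ k, f k ∈ A.D (gd.tgt k)) (k : G) :
    (Fun.of f h : T.Fun).1 k = f k := rfl

theorem Fun.ext {f f' : T.Fun} (h : ∀ k, f.1 k = f'.1 k) : f = f' := Subtype.ext (funext h)

@[simp] theorem Fun.mul_apply (f f' : T.Fun) (k : G) : (f * f').1 k = f.1 k * f'.1 k := rfl

@[simp] theorem Fun.add_apply (f f' : T.Fun) (k : G) : (f + f').1 k = f.1 k + f'.1 k := rfl

@[simp] theorem Fun.one_apply (k : G) : (1 : T.Fun).1 k = T.one (gd.tgt k) := rfl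

@[simp] theorem Fun.zero_apply (k : G) : (0 : T.Fun).1 k = 0 := rfl

variable (T)

theorem one_mul_wt {g e : G} (h : G) (he : gd.tgt g = e) : T.one e * T.wt g h = T.wt g h :=
  T.one_mul (he ▸ T.wt_mem g h)

theorem wt_mul_one {g e : G} (h : G) (he : gd.tgt g = e) : T.wt g h * T.one e = T.wt g h :=
  T.mul_one (he ▸ T.wt_mem g h)

theorem one_mul_vt {g e : G} (h : G) (he : gd.tgt g = e) : T.one e * T.vt g h = T.vt g h :=
  T.one_mul (he ▸ T.vt_mem g h)

theorem one_mul_wt_assoc {g e : G} (h : G) (he : gd.tgt g = e) (x : R) :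
    T.one e * (T.wt g h * x) = T.wt g h * x := by rw [← mul_assoc, T.one_mul_wt h he]

theorem one_mul_vt_assoc {g e : G} (h : G) (he : gd.tgt g = e) (x : R) :
    T.one e * (T.vt g h * x) = T.vt g h * x := by rw [← mul_assoc, T.one_mul_vt h he]

theorem wt_vt_assoc (g h : G) (x : R) :
    T.wt g h * (T.vt g h * x) = T.one (gd.tgt g) * x := by rw [← mul_assoc, T.wt_vt]

theorem vt_wt_assoc (g h : G) (x : R) :
    T.vt g h * (T.wt g h * x) = T.one (gd.tgt g) * x := by rw [← mul_assoc, T.vt_wt]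

variable {T}

theorem Fun.one_mul_apply (f : T.Fun) {k e : G} (he : gd.tgt k = e) :
    T.one e * f.1 k = f.1 k :=
  T.one_mul (he ▸ f.2 k)

theorem Fun.mul_one_apply (f : T.Fun) {k e : G} (he : gd.tgt k = e) :
    f.1 k * T.one e = f.1 k :=
  T.mul_one (he ▸ f.2 k)

theorem Fun.one_mul_apply_assoc (f : T.Fun) {k e : G} (he : gd.tgt k = e) (x : R) :
    T.one e * (f.1 k * x) = f.1 k * x := by rw [← mul_assoc, f.one_mul_apply he]

theorem conj_mem {k g : G} (hkg : gd.comp k g) {x : R} (hx : x ∈ A.D (gd.tgt (gd.mul k g))) :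
    T.wt k g * x * T.vt k g ∈ A.D (gd.tgt k) := by
  rw [gd.tgt_mul _ _ hkg] at hx
  exact mul_mem (mul_mem (T.wt_mem k g) hx) (T.vt_mem k g)

variable (T)

/-- The unit of the functions supported on the elements with source `e`. -/
noncomputable def p (e : G) : T.Fun :=
  Fun.of (fun k => if gd.src k = e then T.one (gd.tgt k) else 0) fun k => by
    split_ifs; exacts [T.one_mem _, zero_mem _]

/-- Right translation by `g`, twisted by conjugation with `wt`. -/
noncomputable def β (g : G) : T.Fun →ₙ+* T.Fun where
  toFun f := Fun.of (fun k => if gd.comp k g then T.wt k g * f.1 (gd.mul k g) * T.vt k g else 0)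
    fun k => by split_ifs with hk; exacts [conj_mem hk (f.2 _), zero_mem _]
  map_zero' := Fun.ext fun k => by simp
  map_add' f f' := Fun.ext fun k => by
    by_cases hk : gd.comp k g <;> simp [hk, mul_add, add_mul]
  map_mul' f f' := Fun.ext fun k => by
    by_cases hk : gd.comp k g <;>
      simp [hk, mul_assoc, vt_wt_assoc, Fun.one_mul_apply_assoc, gd.tgt_mul]

/-- The coboundary of `wt`, extended by `1`. -/
noncomputable def u (g h : G) : T.Funˣ where
  val := Fun.of (fun k => if gd.comp k g ∧ gd.comp g h then
      T.wt k g * T.wt (gd.mul k g) h * T.vt k (gd.mul g h) else T.one (gd.tgt k)) fun k => by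
    split_ifs with hk
    · exact mul_mem (mul_mem (T.wt_mem k g) (gd.tgt_mul _ _ hk.1 ▸ T.wt_mem _ _)) (T.vt_mem _ _)
    · exact T.one_mem _
  inv := Fun.of (fun k => if gd.comp k g ∧ gd.comp g h then
      T.wt k (gd.mul g h) * T.vt (gd.mul k g) h * T.vt k g else T.one (gd.tgt k)) fun k => by
    split_ifs with hk
    · exact mul_mem (mul_mem (T.wt_mem k _) (gd.tgt_mul _ _ hk.1 ▸ T.vt_mem _ _)) (T.vt_mem _ _)
    · exact T.one_mem _
  val_inv := Fun.ext fun k => by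
    by_cases hk : gd.comp k g ∧ gd.comp g h
    · simp [hk, mul_assoc, vt_wt_assoc, wt_vt_assoc, one_mul_vt_assoc, one_mul_vt, wt_vt,
        gd.tgt_mul]
    · simp [hk, one_mul_one]
  inv_val := Fun.ext fun k => by
    by_cases hk : gd.comp k g ∧ gd.comp g h
    · simp [hk, mul_assoc, vt_wt_assoc, one_mul_vt, one_mul_wt_assoc, wt_vt, gd.tgt_mul]
    · simp [hk, one_mul_one]

variable {T}

theorem p_apply (e k : G) : (T.p e).1 k = if gd.src k = e then T.one (gd.tgt k) else 0 := rfl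

theorem β_apply (g : G) (f : T.Fun) {k : G} (hk : gd.comp k g) :
    (T.β g f).1 k = T.wt k g * f.1 (gd.mul k g) * T.vt k g := if_pos hk

theorem β_apply_of_not (g : G) (f : T.Fun) {k : G} (hk : ¬ gd.comp k g) :
    (T.β g f).1 k = 0 := if_neg hk

theorem u_apply {g h k : G} (hk : gd.comp k g) (hgh : gd.comp g h) :
    (T.u g h).1.1 k = T.wt k g * T.wt (gd.mul k g) h * T.vt k (gd.mul g h) :=
  if_pos ⟨hk, hgh⟩

theorem u_inv_apply {g h k : G} (hk : gd.comp k g) (hgh : gd.comp g h) :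
    (↑(T.u g h)⁻¹ : T.Fun).1 k = T.wt k (gd.mul g h) * T.vt (gd.mul k g) h * T.vt k g :=
  if_pos ⟨hk, hgh⟩

theorem u_apply_of_not {g h k : G} (hk : ¬ gd.comp k g) :
    (T.u g h).1.1 k = T.one (gd.tgt k) :=
  if_neg fun h => hk h.1

theorem p_comm (e : G) (f : T.Fun) : T.p e * f = f * T.p e := Fun.ext fun k => by
  by_cases hk : gd.src k = e <;>
    simp [p_apply, hk, Fun.one_mul_apply, Fun.mul_one_apply]

theorem p_mul_p_of_ne {e e' : G} (h : e ≠ e') : T.p e * T.p e' = 0 := Fun.ext fun k => by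
  by_cases hk : gd.src k = e
  · simp [p_apply, hk, h]
  · simp [p_apply, hk]

theorem p_mul_β (g : G) (f : T.Fun) : T.p (gd.tgt g) * T.β g f = T.β g f :=
  Fun.ext fun k => by
    by_cases hk : gd.comp k g
    · simp [p_apply, β_apply _ _ hk, (gd.comp_iff _ _).1 hk, mul_assoc, one_mul_wt_assoc]
    · simp [β_apply_of_not _ _ hk]

theorem β_id {e : G} (he : gd.isId e) (f : T.Fun) : T.β e f = T.p e * f :=
  Fun.ext fun k => by
    by_cases hk : gd.comp k e
    · have hs : gd.src k = e := by rw [(gd.comp_iff _ _).1 hk]; exact he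
      have hv : T.vt k e = T.one (gd.tgt k) := by
        have := T.wt_vt k e
        rwa [T.wt_id_right he, T.one_mul_vt e rfl] at this
      simp [p_apply, hs, β_apply _ _ hk, he.mul_right hk, T.wt_id_right he, hv,
        Fun.one_mul_apply, Fun.mul_one_apply]
    · have hs : gd.src k ≠ e := fun h => hk (by
        rw [gd.comp_iff, h, show gd.tgt e = e from he])
      simp [β_apply_of_not _ _ hk, p_apply, hs]

theorem β_β {g h : G} (hgh : gd.comp g h) (f : T.Fun) :
    T.β g (T.β h f) = T.u g h * T.β (gd.mul g h) f * ↑(T.u g h)⁻¹ :=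
  Fun.ext fun k => by
    by_cases hk : gd.comp k g
    · simp [β_apply _ _ hk, β_apply _ _ (hk.mul_left hgh), β_apply _ _ (hk.mul_right hgh),
        u_apply hk hgh, u_inv_apply hk hgh, mul_assoc, vt_wt_assoc,
        one_mul_vt_assoc, gd.tgt_mul _ _ hk, gd.mul_assoc' _ _ _ hk hgh, Fun.one_mul_apply_assoc,
        gd.tgt_mul _ _ (hk.mul_right hgh)]
    · have hk' : ¬ gd.comp k (gd.mul g h) := by
        rwa [gd.comp_iff, gd.tgt_mul _ _ hgh, ← gd.comp_iff]
      simp [β_apply_of_not _ _ hk, β_apply_of_not _ _ hk']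

theorem β_mul_u {g h t : G} (hgh : gd.comp g h) (hht : gd.comp h t) (f : T.Fun) :
    T.β g (f * T.u h t) =
      T.β g f * (T.u g h * T.u (gd.mul g h) t * ↑(T.u g (gd.mul h t))⁻¹) :=
  Fun.ext fun k => by
    by_cases hk : gd.comp k g
    · simp [β_apply _ _ hk, u_apply hk hgh, u_apply (hk.mul_left hgh) hht,
        u_apply (hk.mul_right hgh) (hgh.mul_left hht), u_inv_apply hk (hgh.mul_right hht),
        mul_assoc, vt_wt_assoc, one_mul_vt_assoc, one_mul_wt_assoc,
        gd.tgt_mul _ _ hk, gd.tgt_mul _ _ (hk.mul_right hgh),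
        gd.mul_assoc' _ _ _ hk hgh, gd.mul_assoc' _ _ _ hgh hht]
    · simp [β_apply_of_not _ _ hk]

theorem β_u_mul {g h t : G} (hgh : gd.comp g h) (hht : gd.comp h t) (f : T.Fun) :
    T.β g (T.u h t * f) =
      (T.u g h * T.u (gd.mul g h) t * ↑(T.u g (gd.mul h t))⁻¹) * T.β g f :=
  Fun.ext fun k => by
    by_cases hk : gd.comp k g
    · simp [β_apply _ _ hk, u_apply hk hgh, u_apply (hk.mul_left hgh) hht,
        u_apply (hk.mul_right hgh) (hgh.mul_left hht), u_inv_apply hk (hgh.mul_right hht),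
        mul_assoc, vt_wt_assoc, one_mul_vt_assoc, one_mul_wt_assoc,
        Fun.one_mul_apply_assoc,
        gd.tgt_mul _ _ hk, gd.tgt_mul _ _ (hk.mul_right hgh),
        gd.mul_assoc' _ _ _ hk hgh, gd.mul_assoc' _ _ _ hgh hht]
    · simp [β_apply_of_not _ _ hk]

theorem u_id_left {e h : G} (he : gd.isId e) (heh : gd.comp e h) : T.u e h = 1 :=
  Units.ext <| Fun.ext fun k => by
    by_cases hk : gd.comp k e
    · simp [u_apply hk heh, he.mul_left heh, he.mul_right hk, T.wt_id_right he, wt_vt,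
        one_mul_one, mul_assoc]
    · simp [u_apply_of_not hk]

theorem u_id_right {g e : G} (he : gd.isId e) (hge : gd.comp g e) : T.u g e = 1 :=
  Units.ext <| Fun.ext fun k => by
    by_cases hk : gd.comp k g
    · simp [u_apply hk hge, he.mul_right hge, T.wt_id_right he, wt_vt, gd.tgt_mul _ _ hk,
        wt_mul_one]
    · simp [u_apply_of_not hk]

theorem u_mul_p_of_ne {g h e : G} (he : e ≠ gd.tgt g) : T.u g h * T.p e = T.p e :=
  Fun.ext fun k => by
    by_cases hk : gd.src k = e
    · have : ¬ gd.comp k g := by rwa [gd.comp_iff, hk]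
      simp [u_apply_of_not this, p_apply, hk, one_mul_one]
    · simp [p_apply, hk]

variable (T)

/-- The embedding of `D e` into the functions supported on the elements with source `e`. -/
noncomputable def φ (e : G) (a : R) : T.Fun :=
  Fun.of (fun k => if gd.src k = e ∧ a ∈ A.D e then A.act k (a * T.one (gd.inv k)) else 0)
    fun k => by
    split_ifs with hk
    · refine A.sub _ (act_mem (mul_mem_left ?_ (T.one_mem _)))
      rw [gd.tgt_inv, hk.1]
      exact hk.2
    · exact zero_mem _

variable {T}

theorem φ_apply {e k : G} (hk : gd.src k = e) {a : R} (ha : a ∈ A.D e) :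
    (T.φ e a).1 k = A.act k (a * T.one (gd.inv k)) := if_pos ⟨hk, ha⟩

theorem φ_apply_of_ne {e k : G} (hk : gd.src k ≠ e) (a : R) :
    (T.φ e a).1 k = 0 := if_neg fun h => hk h.1

theorem φ_of_notMem {e : G} {a : R} (ha : a ∉ A.D e) : T.φ e a = 0 :=
  Fun.ext fun _ => if_neg fun h => ha h.2

theorem mul_one_inv_mem {e k : G} (hk : gd.src k = e) {a : R} (ha : a ∈ A.D e) :
    a * T.one (gd.inv k) ∈ A.D (gd.inv k) :=
  mul_mem_left (by rwa [gd.tgt_inv, hk]) (T.one_mem _)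

theorem p_mul_φ (e : G) (a : R) : T.p e * T.φ e a = T.φ e a := Fun.ext fun k => by
  by_cases hk : gd.src k = e
  · simp [p_apply, hk, Fun.one_mul_apply]
  · simp [φ_apply_of_ne hk]

theorem φ_add {e : G} {a b : R} (ha : a ∈ A.D e) (hb : b ∈ A.D e) :
    T.φ e (a + b) = T.φ e a + T.φ e b := Fun.ext fun k => by
  by_cases hk : gd.src k = e
  · rw [Fun.add_apply, φ_apply hk ha, φ_apply hk hb, φ_apply hk (add_mem ha hb), add_mul,
      A.act_add k _ (mul_one_inv_mem hk ha) _ (mul_one_inv_mem hk hb)]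
  · simp [φ_apply_of_ne hk]

theorem mul_mem_of_isId {e : G} (he : gd.isId e) {a b : R} (ha : a ∈ A.D e) (hb : b ∈ A.D e) :
    a * b ∈ A.D e := mul_mem_left (by rwa [show gd.tgt e = e from he]) hb

theorem φ_mul {e : G} (he : gd.isId e) {a b : R} (ha : a ∈ A.D e) (hb : b ∈ A.D e) :
    T.φ e (a * b) = T.φ e a * T.φ e b := Fun.ext fun k => by
  by_cases hk : gd.src k = e
  · have hb' := mul_one_inv_mem (T := T) hk hb
    rw [Fun.mul_apply, φ_apply hk ha, φ_apply hk hb, φ_apply hk (mul_mem_of_isId he ha hb),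
      ← A.act_mul k _ (mul_one_inv_mem hk ha) _ hb', mul_assoc, mul_assoc, T.one_mul hb']
  · simp [φ_apply_of_ne hk]

theorem φ_apply_self {e : G} (he : gd.isId e) {a : R} (ha : a ∈ A.D e) :
    (T.φ e a).1 e = a := by
  have hc : gd.comp e e := by rw [gd.comp_iff, he.src_eq, show gd.tgt e = e from he]
  have hinv : gd.inv e = e := by
    rw [← he.mul_left (gd.comp_inv_right e), gd.mul_inv_self, show gd.tgt e = e from he]
  rw [φ_apply he.src_eq ha, hinv, T.mul_one ha, A.act_id e he _ ha]

theorem φ_injOn {e : G} (he : gd.isId e) : Set.InjOn (T.φ e) (A.D e) := fun a ha b hb h => by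
  rw [← φ_apply_self (T := T) he ha, h, φ_apply_self he hb]

theorem φ_mul_wt {g h : G} (hgh : gd.comp g h) {a : R} (ha : a ∈ A.D (gd.tgt g)) :
    T.φ (gd.tgt g) (a * T.wt g h) = T.φ (gd.tgt g) a * T.u g h := Fun.ext fun k => by
  by_cases hk : gd.src k = gd.tgt g
  · have hkg := (gd.comp_iff _ _).2 hk
    have hw : T.wt g h ∈ A.D (gd.tgt (gd.inv k)) := by
      rw [gd.tgt_inv, hk]; exact T.wt_mem g h
    rw [φ_apply hk (mul_mem ha (T.wt_mem g h)), mul_assoc, T.comm hw, ← mul_assoc,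
      (T.act_mul_wt hkg hgh (mul_one_inv_mem hk ha)).1, Fun.mul_apply, φ_apply hk ha,
      u_apply hkg hgh]
  · simp [φ_apply_of_ne hk]

theorem φ_wt_mul {g h : G} (hgh : gd.comp g h) {a : R} (ha : a ∈ A.D (gd.tgt g)) :
    T.φ (gd.tgt g) (T.wt g h * a) = T.u g h * T.φ (gd.tgt g) a := Fun.ext fun k => by
  by_cases hk : gd.src k = gd.tgt g
  · have hkg := (gd.comp_iff _ _).2 hk
    rw [φ_apply hk (mul_mem (T.wt_mem g h) ha), mul_assoc,
      (T.act_mul_wt hkg hgh (mul_one_inv_mem hk ha)).2, Fun.mul_apply, φ_apply hk ha,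
      u_apply hkg hgh]
  · simp [φ_apply_of_ne hk]

theorem act_mul_one_mem {g : G} {b : R} (hb : b ∈ A.D (gd.src g)) :
    A.act g (b * T.one (gd.inv g)) ∈ A.D g := act_mem (mul_one_inv_mem rfl hb)

theorem φ_mul_β_φ {g : G} {a b : R} (ha : a ∈ A.D (gd.tgt g)) (hb : b ∈ A.D (gd.src g)) :
    T.φ (gd.tgt g) a * T.β g (T.φ (gd.src g) b) =
      T.φ (gd.tgt g) (a * A.act g (b * T.one (gd.inv g))) := Fun.ext fun k => by
  by_cases hk : gd.src k = gd.tgt g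
  · have hkg := (gd.comp_iff _ _).2 hk
    have hm := A.sub _ (act_mul_one_mem (T := T) hb)
    have hm' : A.act g (b * T.one (gd.inv g)) ∈ A.D (gd.tgt (gd.inv k)) := by
      rwa [gd.tgt_inv, hk]
    rw [Fun.mul_apply, φ_apply hk ha, β_apply _ _ hkg, φ_apply (gd.src_mul _ _ hkg) hb,
      φ_apply hk (mul_mem ha hm), mul_assoc a, T.comm hm', ← mul_assoc a,
      (T.act_mul_act hkg (mul_one_inv_mem hk ha) hb).1]
  · simp [φ_apply_of_ne hk]

theorem β_φ_mul_φ {g : G} {a b : R} (ha : a ∈ A.D (gd.tgt g)) (hb : b ∈ A.D (gd.src g)) :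
    T.β g (T.φ (gd.src g) b) * T.φ (gd.tgt g) a =
      T.φ (gd.tgt g) (A.act g (b * T.one (gd.inv g)) * a) := Fun.ext fun k => by
  by_cases hk : gd.src k = gd.tgt g
  · have hkg := (gd.comp_iff _ _).2 hk
    have hm := A.sub _ (act_mul_one_mem (T := T) hb)
    rw [Fun.mul_apply, φ_apply hk ha, β_apply _ _ hkg, φ_apply (gd.src_mul _ _ hkg) hb,
      φ_apply hk (mul_mem hm ha), mul_assoc (A.act g _) a,
      (T.act_mul_act hkg (mul_one_inv_mem hk ha) hb).2]
  · simp [φ_apply_of_ne hk]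

theorem β_φ {g : G} {a : R} (ha : a ∈ A.D (gd.inv g)) :
    T.β g (T.φ (gd.src g) a) = T.φ (gd.tgt g) (A.act g a) := Fun.ext fun k => by
  by_cases hk : gd.src k = gd.tgt g
  · have hkg := (gd.comp_iff _ _).2 hk
    rw [β_apply _ _ hkg, φ_apply (gd.src_mul _ _ hkg) (mem_src ha),
      φ_apply hk (A.sub _ (act_mem ha)), T.act_act_mul_one hkg ha]
  · rw [φ_apply_of_ne hk, β_apply_of_not _ _ (fun h => hk ((gd.comp_iff _ _).1 h))]

end RingTPA.ExtendedTwist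

namespace RingTPA.ExtendedTwist

/-- The units which, together with their inverses, multiply a subgroup into itself. -/
def stab {F : Type*} [Ring F] (K : AddSubgroup F) : Subgroup Fˣ where
  carrier := {x | ∀ y ∈ K, (x * y ∈ K ∧ y * x ∈ K) ∧ (↑x⁻¹ * y ∈ K ∧ y * ↑x⁻¹ ∈ K)}
  mul_mem' {a b} ha hb y hy := by
    simp only [mul_inv_rev, Units.val_mul, mul_assoc]
    simp only [← mul_assoc y]
    exact ⟨⟨(ha _ (hb _ hy).1.1).1.1, (hb _ (ha _ hy).1.2).1.2⟩,
      (hb _ (ha _ hy).2.1).2.1, (ha _ (hb _ hy).2.2).2.2⟩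
  one_mem' y hy := by simpa using hy
  inv_mem' {a} ha y hy := by
    rw [inv_inv]
    exact ⟨(ha y hy).2, (ha y hy).1⟩

theorem stab_conj {F : Type*} [Ring F] {K : AddSubgroup F} {x : Fˣ} (hx : x ∈ stab K) {y : F}
    (hy : y ∈ K) : x * y * ↑x⁻¹ ∈ K :=
  (hx _ (hx _ hy).1.1).2.2

variable {G : Type u} {R : Type v} [NonUnitalRing R] {gd : PGroupoid G} {A : RingTPA gd R}
  {T : ExtendedTwist A}

theorem u_of_not_comp {g h : G} (hgh : ¬ gd.comp g h) : T.u g h = 1 :=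
  Units.ext <| Fun.ext fun _ => if_neg fun h => hgh h.2

theorem β_mul_u_inv {g h t : G} (hgh : gd.comp g h) (hht : gd.comp h t) (f : T.Fun) :
    T.β g (f * ↑(T.u h t)⁻¹) =
      T.β g f * ↑(T.u g h * T.u (gd.mul g h) t * (T.u g (gd.mul h t))⁻¹)⁻¹ := by
  rw [Units.eq_mul_inv_iff_mul_eq, Units.val_mul, Units.val_mul, ← β_mul_u hgh hht,
    Units.inv_mul_cancel_right]

theorem β_u_inv_mul {g h t : G} (hgh : gd.comp g h) (hht : gd.comp h t) (f : T.Fun) :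
    T.β g (↑(T.u h t)⁻¹ * f) =
      ↑(T.u g h * T.u (gd.mul g h) t * (T.u g (gd.mul h t))⁻¹)⁻¹ * T.β g f := by
  rw [Units.eq_inv_mul_iff_mul_eq, Units.val_mul, Units.val_mul, ← β_u_mul hgh hht,
    Units.mul_inv_cancel_left]

theorem p_u_comm (e g h : G) : T.p e * T.u g h = T.u g h * T.p e := p_comm _ _

variable (T)

/-- A one-sided inverse of `β g` up to the units of the supports. -/
noncomputable def βinv (g : G) (f : T.Fun) : T.Fun :=
  ↑(T.u (gd.inv g) g)⁻¹ * T.β (gd.inv g) f * T.u (gd.inv g) g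

variable {T}

theorem β_inv_β (g : G) (f : T.Fun) : T.β (gd.inv g) (T.β g f) =
    T.u (gd.inv g) g * (T.p (gd.src g) * f) * ↑(T.u (gd.inv g) g)⁻¹ := by
  rw [β_β (gd.comp_inv_left g), gd.inv_mul_self, β_id (gd.tgt_src g)]

theorem βinv_β (g : G) (f : T.Fun) : T.βinv g (T.β g f) = T.p (gd.src g) * f := by
  rw [βinv, β_inv_β]
  simp [mul_assoc]

theorem β_βinv (g : G) (f : T.Fun) : T.β g (T.βinv g f) = T.p (gd.tgt g) * f := by
  have h1 := gd.comp_inv_right g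
  have h2 := gd.comp_inv_left g
  rw [βinv, β_mul_u h1 h2, β_u_inv_mul h1 h2, β_β h1, gd.mul_inv_self, gd.inv_mul_self,
    u_id_left (gd.tgt_tgt g) (gd.comp_tgt_self g), u_id_right (gd.tgt_src g) (gd.comp_src_self g),
    β_id (gd.tgt_tgt g)]
  simp [mul_assoc]

variable (T)

/-- The image of `D e` under `φ e`. -/
noncomputable def J (e : G) : AddSubgroup T.Fun :=
  (AddMonoidHom.mk' (fun a : A.D e => T.φ e a) fun a b => φ_add a.2 b.2).range

/-- The image of `D (src m)` under `β m ∘ φ (src m)`. -/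
noncomputable def I (m : G) : AddSubgroup T.Fun :=
  (T.J (gd.src m)).map (T.β m : T.Fun →+ T.Fun)

variable {T}

theorem mem_J {e : G} {x : T.Fun} : x ∈ T.J e ↔ ∃ a ∈ A.D e, T.φ e a = x := by
  simp [J]

theorem mem_I {m : G} {y : T.Fun} : y ∈ T.I m ↔ ∃ x ∈ T.J (gd.src m), T.β m x = y := Iff.rfl

theorem φ_mem_J {e : G} {a : R} (ha : a ∈ A.D e) : T.φ e a ∈ T.J e := mem_J.2 ⟨a, ha, rfl⟩

theorem p_mul_of_mem_J {e : G} {x : T.Fun} (hx : x ∈ T.J e) : T.p e * x = x := by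
  obtain ⟨a, -, rfl⟩ := mem_J.1 hx
  exact p_mul_φ e a

theorem p_mul_of_mem_I {m : G} {y : T.Fun} (hy : y ∈ T.I m) : T.p (gd.tgt m) * y = y := by
  obtain ⟨x, -, rfl⟩ := mem_I.1 hy
  exact p_mul_β m x

theorem u_mem_stab_J {g h e : G} (hgh : gd.comp g h) (he : gd.tgt g = e) :
    T.u g h ∈ stab (T.J e) := by
  subst he
  intro y hy
  obtain ⟨a, ha, rfl⟩ := mem_J.1 hy
  have hw := T.wt_mem g h
  have hv := T.vt_mem g h
  refine ⟨⟨?_, ?_⟩, ?_, ?_⟩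
  · exact φ_wt_mul (T := T) hgh ha ▸ φ_mem_J (mul_mem hw ha)
  · exact φ_mul_wt (T := T) hgh ha ▸ φ_mem_J (mul_mem ha hw)
  · have : T.φ (gd.tgt g) (T.vt g h * a) = ↑(T.u g h)⁻¹ * T.φ (gd.tgt g) a := by
      rw [Units.eq_inv_mul_iff_mul_eq, ← φ_wt_mul hgh (mul_mem hv ha), ← mul_assoc, T.wt_vt,
        T.one_mul ha]
    exact this ▸ φ_mem_J (mul_mem hv ha)
  · have : T.φ (gd.tgt g) (a * T.vt g h) = T.φ (gd.tgt g) a * ↑(T.u g h)⁻¹ := by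
      rw [Units.eq_mul_inv_iff_mul_eq, ← φ_mul_wt hgh (mul_mem ha hv), mul_assoc, T.vt_wt,
        T.mul_one ha]
    exact this ▸ φ_mem_J (mul_mem ha hv)

theorem mem_I_iff {m : G} {y : T.Fun} :
    y ∈ T.I m ↔ T.p (gd.tgt m) * y = y ∧ T.β (gd.inv m) y ∈ T.J (gd.src m) := by
  have hu : T.u (gd.inv m) m ∈ stab (T.J (gd.src m)) :=
    u_mem_stab_J (gd.comp_inv_left m) (gd.tgt_inv m)
  constructor
  · intro hy
    refine ⟨p_mul_of_mem_I hy, ?_⟩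
    obtain ⟨x, hx, rfl⟩ := mem_I.1 hy
    rw [β_inv_β, p_mul_of_mem_J hx]
    exact stab_conj hu hx
  · rintro ⟨h1, h2⟩
    refine mem_I.2 ⟨T.βinv m y, ?_, by rw [β_βinv, h1]⟩
    simpa [βinv] using stab_conj (inv_mem hu) h2

theorem J_eq_I {e : G} (he : gd.isId e) : T.J e = T.I e := by
  ext y
  rw [mem_I, he.src_eq]
  constructor
  · exact fun hy => ⟨y, hy, by rw [β_id he, p_mul_of_mem_J hy]⟩
  · rintro ⟨x, hx, rfl⟩
    rwa [β_id he, p_mul_of_mem_J hx]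

theorem mul_eq_zero_of_ne {e e' : G} (h : e ≠ e') {x y : T.Fun} (hx : T.p e * x = x)
    (hy : T.p e' * y = y) : x * y = 0 := by
  rw [← hx, ← hy, p_comm e x, mul_assoc, ← mul_assoc (T.p e), p_mul_p_of_ne h, zero_mul, mul_zero]

theorem u_mem_stab_I (g h m : G) : T.u g h ∈ stab (T.I m) := by
  by_cases hgh : gd.comp g h
  swap
  · rw [u_of_not_comp hgh]
    exact one_mem _
  intro y hy
  by_cases hgm : gd.tgt m = gd.tgt g
  · have hc : gd.comp (gd.inv m) g := PGroupoid.comp_inv_of_tgt_eq hgm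
    obtain ⟨hp, hJ⟩ := mem_I_iff.1 hy
    have hW : T.u (gd.inv m) g * T.u (gd.mul (gd.inv m) g) h *
        (T.u (gd.inv m) (gd.mul g h))⁻¹ ∈ stab (T.J (gd.src m)) :=
      Subgroup.mul_mem _ (Subgroup.mul_mem _ (u_mem_stab_J hc (gd.tgt_inv m))
        (u_mem_stab_J (hc.mul_left hgh) (by rw [gd.tgt_mul _ _ hc, gd.tgt_inv])))
        (inv_mem (u_mem_stab_J (hc.mul_right hgh) (gd.tgt_inv m)))
    obtain ⟨⟨h1, h2⟩, h3, h4⟩ := hW _ hJ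
    have hpl : ∀ f : T.Fun, T.p (gd.tgt m) * (f * y) = f * y := fun f => by
      rw [← mul_assoc, p_comm, mul_assoc, hp]
    have hpr : ∀ f : T.Fun, T.p (gd.tgt m) * (y * f) = y * f := fun f => by
      rw [← mul_assoc, hp]
    refine ⟨⟨mem_I_iff.2 ⟨hpl _, ?_⟩, mem_I_iff.2 ⟨hpr _, ?_⟩⟩,
      mem_I_iff.2 ⟨hpl _, ?_⟩, mem_I_iff.2 ⟨hpr _, ?_⟩⟩
    · rw [β_u_mul hc hgh]; exact h1
    · rw [β_mul_u hc hgh]; exact h2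
    · rw [β_u_inv_mul hc hgh]; exact h3
    · rw [β_mul_u_inv hc hgh]; exact h4
  · have hl : T.u g h * y = y := by
      rw [← p_mul_of_mem_I hy, ← mul_assoc, u_mul_p_of_ne hgm]
    have hr : y * T.u g h = y := by
      rw [← p_mul_of_mem_I hy, p_comm, mul_assoc, p_u_comm, u_mul_p_of_ne hgm]
    refine ⟨⟨by rwa [hl], by rwa [hr]⟩, ?_, ?_⟩
    · rwa [← hl, Units.inv_mul_cancel_left]
    · rwa [← hr, Units.mul_inv_cancel_right]

theorem β_mem_I {g m : G} (hgm : gd.comp g m) {y : T.Fun} (hy : y ∈ T.I m) :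
    T.β g y ∈ T.I (gd.mul g m) := by
  have hc : gd.comp (gd.inv (gd.mul g m)) g :=
    PGroupoid.comp_inv_of_tgt_eq (gd.tgt_mul _ _ hgm)
  have hc' : gd.comp (gd.inv m) (gd.inv g) := by
    rw [gd.comp_iff, gd.src_inv, gd.tgt_inv, (gd.comp_iff _ _).1 hgm]
  have hmul : gd.mul (gd.inv (gd.mul g m)) g = gd.inv m := by
    have := PGroupoid.mul_inv_cancel_right hc'
    rwa [gd.inv_inv, ← gd.inv_mul_rev _ _ hgm] at this
  refine mem_I_iff.2 ⟨by rw [gd.tgt_mul _ _ hgm, p_mul_β], ?_⟩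
  rw [β_β hc, hmul, gd.src_mul _ _ hgm]
  exact stab_conj (u_mem_stab_J hc (by rw [gd.tgt_inv, gd.src_mul _ _ hgm])) (mem_I_iff.1 hy).2

theorem βinv_mem_I {g m : G} (hgm : gd.tgt g = gd.tgt m) {y : T.Fun} (hy : y ∈ T.I m) :
    T.βinv g y ∈ T.I (gd.mul (gd.inv g) m) := by
  simpa [βinv] using stab_conj (inv_mem (u_mem_stab_I (gd.inv g) g _))
    (β_mem_I (PGroupoid.comp_inv_of_tgt_eq hgm) hy)

theorem mul_mem_J_of_mem_I {g : G} {x y : T.Fun} (hx : x ∈ T.I g) (hy : y ∈ T.J (gd.tgt g)) :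
    x * y ∈ T.J (gd.tgt g) ∧ y * x ∈ T.J (gd.tgt g) := by
  obtain ⟨x, hx', rfl⟩ := mem_I.1 hx
  obtain ⟨b, hb, rfl⟩ := mem_J.1 hx'
  obtain ⟨a, ha, rfl⟩ := mem_J.1 hy
  have hm := A.sub _ (act_mul_one_mem (T := T) hb)
  exact ⟨β_φ_mul_φ ha hb ▸ φ_mem_J (mul_mem hm ha), φ_mul_β_φ ha hb ▸ φ_mem_J (mul_mem ha hm)⟩

theorem mul_mem_I {n m : G} {x y : T.Fun} (hx : x ∈ T.I n) (hy : y ∈ T.I m) :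
    x * y ∈ T.I m ∧ y * x ∈ T.I m := by
  by_cases hnm : gd.tgt m = gd.tgt n
  · have hc : gd.comp (gd.inv m) n := PGroupoid.comp_inv_of_tgt_eq hnm
    obtain ⟨hp, hJ⟩ := mem_I_iff.1 hy
    have ht : gd.tgt (gd.mul (gd.inv m) n) = gd.src m := by rw [gd.tgt_mul _ _ hc, gd.tgt_inv]
    have := mul_mem_J_of_mem_I (β_mem_I hc hx) (ht ▸ hJ)
    rw [ht] at this
    refine ⟨mem_I_iff.2 ⟨?_, map_mul (T.β _) x y ▸ this.1⟩,
      mem_I_iff.2 ⟨?_, map_mul (T.β _) y x ▸ this.2⟩⟩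
    · rw [← mul_assoc, p_comm, mul_assoc, hp]
    · rw [← mul_assoc, hp]
  · rw [mul_eq_zero_of_ne (Ne.symm hnm) (p_mul_of_mem_I hx) (p_mul_of_mem_I hy),
      mul_eq_zero_of_ne hnm (p_mul_of_mem_I hy) (p_mul_of_mem_I hx)]
    exact ⟨zero_mem _, zero_mem _⟩

variable (T)

/-- The ring of functions which multiply all `I m` into themselves. -/
noncomputable def idealizer : NonUnitalSubring T.Fun where
  carrier := {f | ∀ m, ∀ y ∈ T.I m, f * y ∈ T.I m ∧ y * f ∈ T.I m}
  add_mem' hf hg m y hy := by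
    rw [add_mul, mul_add]
    exact ⟨add_mem (hf m y hy).1 (hg m y hy).1, add_mem (hf m y hy).2 (hg m y hy).2⟩
  zero_mem' m y _ := by
    rw [zero_mul, mul_zero]
    exact ⟨zero_mem _, zero_mem _⟩
  neg_mem' hf m y hy := by
    rw [neg_mul, mul_neg]
    exact ⟨neg_mem (hf m y hy).1, neg_mem (hf m y hy).2⟩
  mul_mem' hf hg m y hy := by
    rw [mul_assoc, ← mul_assoc y]
    exact ⟨(hf m _ (hg m y hy).1).1, (hg m _ (hf m y hy).2).2⟩

variable {T}

theorem mem_idealizer_of_mem_I {n : G} {x : T.Fun} (hx : x ∈ T.I n) : x ∈ T.idealizer :=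
  fun _ _ hy => mul_mem_I hx hy

theorem u_mem_idealizer (g h : G) : (T.u g h : T.Fun) ∈ T.idealizer :=
  fun m y hy => (u_mem_stab_I g h m y hy).1

theorem u_inv_mem_idealizer (g h : G) : (↑(T.u g h)⁻¹ : T.Fun) ∈ T.idealizer :=
  fun m y hy => (u_mem_stab_I g h m y hy).2

theorem β_mem_idealizer (g : G) {f : T.Fun} (hf : f ∈ T.idealizer) : T.β g f ∈ T.idealizer := by
  intro m y hy
  by_cases hgm : gd.tgt g = gd.tgt m
  · have hy' := βinv_mem_I hgm hy
    have hc := PGroupoid.comp_inv_of_tgt_eq hgm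
    have hc' : gd.comp g (gd.mul (gd.inv g) m) := (gd.comp_inv_right g).mul_right hc
    have heq : T.β g (T.βinv g y) = y := by rw [β_βinv, hgm, p_mul_of_mem_I hy]
    have h := PGroupoid.mul_inv_cancel_left hgm
    have h1 := β_mem_I hc' (hf _ _ hy').1
    have h2 := β_mem_I hc' (hf _ _ hy').2
    rw [map_mul, heq, h] at h1 h2
    exact ⟨h1, h2⟩
  · rw [mul_eq_zero_of_ne hgm (p_mul_β g f) (p_mul_of_mem_I hy),
      mul_eq_zero_of_ne (Ne.symm hgm) (p_mul_of_mem_I hy) (p_mul_β g f)]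
    exact ⟨zero_mem _, zero_mem _⟩

theorem βinv_mem_idealizer (g : G) {f : T.Fun} (hf : f ∈ T.idealizer) :
    T.βinv g f ∈ T.idealizer :=
  NonUnitalSubring.mul_mem _
    (NonUnitalSubring.mul_mem _ (u_inv_mem_idealizer _ _) (β_mem_idealizer _ hf))
    (u_mem_idealizer _ _)

theorem φ_mem_idealizer (e : G) (a : R) : T.φ e a ∈ T.idealizer := by
  by_cases ha : a ∈ A.D e
  · by_cases he : gd.isId e
    · exact mem_idealizer_of_mem_I (J_eq_I (T := T) he ▸ φ_mem_J ha)
    · have : T.φ e a = 0 := Fun.ext fun k => φ_apply_of_ne (fun h => he (by rw [PGroupoid.isId, ← h, gd.tgt_src])) a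
      rw [this]
      exact zero_mem _
  · rw [φ_of_notMem ha]
    exact zero_mem _

end RingTPA.ExtendedTwist

namespace RingTPA.ExtendedTwist

variable {G : Type u} {R : Type v} [NonUnitalRing R] {gd : PGroupoid G} {A : RingTPA gd R}
  (T : ExtendedTwist A)

/-- The ideal of the globalizing ring attached to the identity `e`. -/
noncomputable def E (e : G) : AddSubgroup T.idealizer :=
  AddSubgroup.closure {x | ∃ h, gd.tgt h = e ∧ x.1 ∈ T.I h}

/-- The restriction of `β g` to the idealizer. -/
noncomputable def act (g : G) (x : T.idealizer) : T.idealizer :=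
  ⟨T.β g x.1, β_mem_idealizer g x.2⟩

/-- The restriction of `βinv g` to the idealizer. -/
noncomputable def actinv (g : G) (x : T.idealizer) : T.idealizer :=
  ⟨T.βinv g x.1, βinv_mem_idealizer g x.2⟩

/-- `φ e` as a map to the idealizer. -/
noncomputable def emb (e : G) (a : R) : T.idealizer := ⟨T.φ e a, φ_mem_idealizer e a⟩

variable {T}

theorem mem_E_of_mem_I {x : T.idealizer} {h e : G} (he : gd.tgt h = e) (hx : x.1 ∈ T.I h) :
    x ∈ T.E e := AddSubgroup.subset_closure ⟨h, he, hx⟩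

theorem p_mul_of_mem_E {e : G} {x : T.idealizer} (hx : x ∈ T.E e) : T.p e * x.1 = x.1 := by
  induction hx using AddSubgroup.closure_induction with
  | mem x hx =>
    obtain ⟨h, rfl, hx⟩ := hx
    exact p_mul_of_mem_I hx
  | zero => exact mul_zero _
  | add x y _ _ hx hy =>
    change T.p e * (x.1 + y.1) = x.1 + y.1
    rw [mul_add, hx, hy]
  | neg x _ hx =>
    change T.p e * -x.1 = -x.1
    rw [mul_neg, hx]

theorem mul_mem_E {e : G} (s : T.idealizer) {x : T.idealizer} (hx : x ∈ T.E e) :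
    s * x ∈ T.E e ∧ x * s ∈ T.E e := by
  induction hx using AddSubgroup.closure_induction with
  | mem x hx =>
    obtain ⟨h, rfl, hx⟩ := hx
    exact ⟨mem_E_of_mem_I rfl (s.2 h _ hx).1, mem_E_of_mem_I rfl (s.2 h _ hx).2⟩
  | zero => simp [zero_mem]
  | add x y _ _ hx hy =>
    rw [mul_add, add_mul]
    exact ⟨add_mem hx.1 hy.1, add_mem hx.2 hy.2⟩
  | neg x _ hx =>
    rw [mul_neg, neg_mul]
    exact ⟨neg_mem hx.1, neg_mem hx.2⟩

theorem act_zero (g : G) : T.act g 0 = 0 := Subtype.ext (map_zero (T.β g))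

theorem act_add (g : G) (x y : T.idealizer) : T.act g (x + y) = T.act g x + T.act g y :=
  Subtype.ext (map_add (T.β g) x.1 y.1)

theorem act_neg (g : G) (x : T.idealizer) : T.act g (-x) = -T.act g x :=
  Subtype.ext (map_neg (T.β g) x.1)

theorem act_mul (g : G) (x y : T.idealizer) : T.act g (x * y) = T.act g x * T.act g y :=
  Subtype.ext (map_mul (T.β g) x.1 y.1)

theorem act_mem_E {g : G} {x : T.idealizer} (hx : x ∈ T.E (gd.src g)) :
    T.act g x ∈ T.E (gd.tgt g) := by
  induction hx using AddSubgroup.closure_induction with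
  | mem x hx =>
    obtain ⟨h, hh, hx⟩ := hx
    have hgh := (gd.comp_iff _ _).2 hh.symm
    exact mem_E_of_mem_I (gd.tgt_mul _ _ hgh) (β_mem_I hgh hx)
  | zero =>
    rw [act_zero]
    exact zero_mem _
  | add x y _ _ hx hy => exact act_add g x y ▸ add_mem hx hy
  | neg x _ hx => exact act_neg g x ▸ neg_mem hx

theorem actinv_mem_E {g : G} {x : T.idealizer} (hx : x ∈ T.E (gd.tgt g)) :
    T.actinv g x ∈ T.E (gd.src g) := by
  have hx' : T.act (gd.inv g) x ∈ T.E (gd.src g) := by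
    rw [← gd.tgt_inv]
    exact act_mem_E (by rwa [gd.src_inv])
  let v : T.idealizer := ⟨_, u_inv_mem_idealizer (gd.inv g) g⟩
  let w : T.idealizer := ⟨_, u_mem_idealizer (gd.inv g) g⟩
  exact (mul_mem_E w (mul_mem_E v hx').1).2

theorem act_actinv {g : G} {x : T.idealizer} (hx : x ∈ T.E (gd.tgt g)) :
    T.act g (T.actinv g x) = x :=
  Subtype.ext ((β_βinv g x.1).trans (p_mul_of_mem_E hx))

theorem actinv_act {g : G} {x : T.idealizer} (hx : x ∈ T.E (gd.src g)) :
    T.actinv g (T.act g x) = x :=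
  Subtype.ext ((βinv_β g x.1).trans (p_mul_of_mem_E hx))

theorem bijOn_act (g : G) : Set.BijOn (T.act g) (T.E (gd.src g)) (T.E (gd.tgt g)) :=
  Set.InvOn.bijOn ⟨fun _ hx => actinv_act hx, fun _ hx => act_actinv hx⟩
    (fun _ hx => act_mem_E hx) (fun _ hx => actinv_mem_E hx)

theorem emb_mem_E {e : G} (he : gd.isId e) {a : R} (ha : a ∈ A.D e) : T.emb e a ∈ T.E e :=
  mem_E_of_mem_I he (J_eq_I (T := T) he ▸ φ_mem_J ha)

theorem mulAdd_E_self (e : G) : setMulAdd (T.E e : Set T.idealizer) (T.E e) = T.E e := by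
  apply le_antisymm
  · rw [setMulAdd, AddSubgroup.closure_le]
    rintro _ ⟨x, -, y, hy, rfl⟩
    exact (mul_mem_E x hy).1
  · rw [E, AddSubgroup.closure_le]
    rintro x ⟨h, rfl, hx⟩
    obtain ⟨z, hz, hzx⟩ := mem_I.1 hx
    obtain ⟨b, hb, rfl⟩ := mem_J.1 hz
    have he : gd.isId (gd.src h) := gd.tgt_src h
    have h1 := T.one_mem (gd.src h)
    refine AddSubgroup.subset_closure ⟨x, mem_E_of_mem_I rfl hx,
      T.act h (T.emb (gd.src h) (T.one (gd.src h))), act_mem_E (emb_mem_E he h1), ?_⟩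
    refine Subtype.ext ?_
    change x.1 = x.1 * T.β h (T.φ _ _)
    rw [← hzx, ← map_mul, ← φ_mul he hb h1, T.mul_one hb]

theorem mulAdd_E_of_ne {e e' : G} (h : e ≠ e') :
    setMulAdd (T.E e : Set T.idealizer) (T.E e') = ⊥ := by
  rw [eq_bot_iff, setMulAdd, AddSubgroup.closure_le]
  rintro _ ⟨x, hx, y, hy, rfl⟩
  exact Subtype.ext (mul_eq_zero_of_ne h (p_mul_of_mem_E hx) (p_mul_of_mem_E hy))

variable (T)

/-- The global twisted action on the idealizer. -/
noncomputable def globalAction : RingTPA gd T.idealizer where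
  D g := T.E (gd.tgt g)
  act := T.act
  actinv := T.actinv
  w g h := ⟨T.u g h, u_mem_idealizer g h⟩
  winv g h := ⟨↑(T.u g h)⁻¹, u_inv_mem_idealizer g h⟩
  ideal_top _ r _ hx := mul_mem_E r hx
  sub g := by rw [gd.tgt_tgt]
  ideal_in _ a _ _ hx := mul_mem_E a hx
  act_bij g := by simpa only [gd.tgt_inv] using bijOn_act g
  act_add g a _ b _ := act_add g a b
  act_mul g a _ b _ := act_mul g a b
  actinv_mem g a ha := by simpa only [gd.tgt_inv] using actinv_mem_E ha
  act_actinv g a ha := act_actinv ha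
  actinv_act g a ha := actinv_act (by simpa only [gd.tgt_inv] using ha)
  sq g := mulAdd_E_self _
  comm g h := by
    by_cases hgh : gd.tgt g = gd.tgt h
    · rw [hgh]
    · rw [mulAdd_E_of_ne hgh, mulAdd_E_of_ne (Ne.symm hgh)]
  id_eq e _ := by rw [gd.tgt_tgt]
  act_id e he a ha := Subtype.ext <| (β_id he _).trans
    (p_mul_of_mem_E (by rwa [show gd.tgt e = e from he] at ha))
  act_ideal g h hgh := by
    rw [gd.tgt_inv, (gd.comp_iff _ _).1 hgh, mulAdd_E_self, gd.tgt_mul _ _ hgh, mulAdd_E_self,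
      ← (gd.comp_iff _ _).1 hgh]
    exact (bijOn_act g).image_eq
  w_mul_mem g h hgh x hx := by
    rw [gd.tgt_mul _ _ hgh, mulAdd_E_self] at hx ⊢
    exact mul_mem_E _ hx
  winv_mul_mem g h hgh x hx := by
    rw [gd.tgt_mul _ _ hgh, mulAdd_E_self] at hx ⊢
    exact mul_mem_E _ hx
  w_winv g h _ x _ := ⟨Subtype.ext (Units.mul_inv_cancel_left _ _),
    Subtype.ext (Units.inv_mul_cancel_left _ _), Subtype.ext (Units.mul_inv_cancel_right _ _),
    Subtype.ext (Units.inv_mul_cancel_right _ _)⟩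
  act_act g h hgh a _ := Subtype.ext (β_β hgh a.1)
  w_id_left g x _ := by
    have := u_id_left (T := T) (gd.tgt_tgt g) (gd.comp_tgt_self g)
    exact ⟨Subtype.ext (by simp [this]), Subtype.ext (by simp [this])⟩
  w_id_right g x _ := by
    have := u_id_right (T := T) (gd.tgt_src g) (gd.comp_src_self g)
    exact ⟨Subtype.ext (by simp [this]), Subtype.ext (by simp [this])⟩
  w_cocycle g h t hgh hht a _ := Subtype.ext <| by
    change T.β g (a.1 * T.u h t) * T.u g (gd.mul h t) =
      T.β g a.1 * T.u g h * T.u (gd.mul g h) t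
    rw [β_mul_u hgh hht]
    simp [mul_assoc]

theorem emb_image (e : G) {x : T.idealizer} :
    x ∈ T.emb e '' (A.D e : Set R) ↔ x.1 ∈ T.J e := by
  simp [mem_J, emb, Subtype.ext_iff]

theorem act_emb_image (g : G) {x : T.idealizer} :
    x ∈ T.act g '' (T.emb (gd.src g) '' (A.D (gd.src g) : Set R)) ↔ x.1 ∈ T.I g := by
  simp [mem_I, mem_J, act, emb, Subtype.ext_iff, φ_mem_idealizer]

/-- The globalization attached to an extended twist. -/
noncomputable def globalization : RingGlobalization gd A T.idealizer where
  B := T.globalAction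
  global g := congrArg T.E (gd.tgt_tgt g).symm
  φ := T.emb
  φ_add e _ a ha b hb := Subtype.ext (φ_add ha hb)
  φ_mul e he a ha b hb := Subtype.ext (φ_mul he ha hb)
  φ_inj e he a ha b hb h := φ_injOn he ha hb (congrArg Subtype.val h)
  φ_mapsTo e he a ha := by
    change _ ∈ T.E (gd.tgt e)
    rw [show gd.tgt e = e from he]
    exact emb_mem_E he ha
  φ_ideal e he s _ x hx := by
    simp only [emb_image, J_eq_I he] at hx ⊢
    exact s.2 e _ hx
  sum_cond g := by
    refine congrArg AddSubgroup.closure (Set.ext fun x => ?_)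
    simp only [Set.mem_iUnion, globalAction, act_emb_image]
    simp
  inter_cond g := by
    refine Set.Subset.antisymm ?_ ?_
    · rintro _ ⟨a, ha, rfl⟩
      obtain ⟨b, hb, rfl⟩ := (A.act_bij g).surjOn ha
      exact ⟨⟨_, A.sub g ha, rfl⟩, _, ⟨b, mem_src hb, rfl⟩, Subtype.ext (β_φ hb)⟩
    · rintro _ ⟨⟨a, ha, rfl⟩, _, ⟨b, hb, rfl⟩, h⟩
      have h' : T.β g (T.φ (gd.src g) b) = T.φ (gd.tgt g) a := congrArg Subtype.val h
      have h1 := T.one_mem (gd.tgt g)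
      have hm := act_mul_one_mem (T := T) hb
      refine ⟨_, hm, Subtype.ext ?_⟩
      change T.φ _ _ = T.φ _ _
      rw [← T.one_mul (A.sub g hm), ← φ_mul_β_φ h1 hb, h', ← φ_mul (gd.tgt_tgt g) h1 ha,
        T.one_mul ha]
  equivar g a ha := Subtype.ext (β_φ ha)
  w_cond g h hgh a ha := by
    obtain ⟨h1, h2⟩ := (T.mem_mulAdd_iff (gd.tgt_mul _ _ hgh).symm).1 ha
    rw [T.mul_w hgh h1 h2, T.w_mul hgh h1 h2]
    exact ⟨Subtype.ext (φ_mul_wt hgh (A.sub g h1)), Subtype.ext (φ_wt_mul hgh (A.sub g h1))⟩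

end RingTPA.ExtendedTwist

/-- Let `A` be a twisted partial action of a groupoid `gd` on a ring `R`
such that each ideal `D g` is unital with identity `one g`.  Then `A` admits a globalization
if and only if for each composable pair `(g,h)` there is an invertible element
`wt g h ∈ U(D (r g))` such that `wt g h * 1_g * 1_{gh} = w g h` (as multipliers of
`D_g · D_{gh}`) and, for every `t` with `(h,t)` composable,
`α_g(wt h t * 1_{g⁻¹}) * wt g (ht) = 1_g * wt g h * wt (gh) t`. -/
theorem statement0 {G : Type u} {R : Type v} [NonUnitalRing R] (gd : PGroupoid G)
    (A : RingTPA gd R) (one : G → R)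
    (hone_mem : ∀ g, one g ∈ A.D g)
    (hone : ∀ g, ∀ x ∈ A.D g, one g * x = x ∧ x * one g = x) :
    (∃ (S : Type (max u v)) (_ : NonUnitalRing S), Nonempty (RingGlobalization gd A S)) ↔
    (∃ wt : G → G → R, ∀ g h, gd.comp g h →
        (wt g h ∈ A.D (gd.tgt g) ∧
          ∃ vt ∈ A.D (gd.tgt g),
            wt g h * vt = one (gd.tgt g) ∧ vt * wt g h = one (gd.tgt g)) ∧
        (∀ x ∈ setMulAdd ((A.D g : Set R)) ((A.D (gd.mul g h) : Set R)),
            A.w g h * x = wt g h * (one g * one (gd.mul g h)) * x ∧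
            x * A.w g h = x * (wt g h * (one g * one (gd.mul g h)))) ∧
        (∀ t, gd.comp h t →
            A.act g (wt h t * one (gd.inv g)) * wt g (gd.mul h t) =
              one g * wt g h * wt (gd.mul g h) t)) := by
  let U : A.LocalUnits :=
    ⟨one, hone_mem, fun {g x} hx => (hone g x hx).1, fun {g x} hx => (hone g x hx).2⟩
  constructor
  · rintro ⟨S, _, ⟨Γ⟩⟩
    exact Γ.exists_twist U
  · intro H
    obtain ⟨T⟩ := U.nonempty_extendedTwist H
    exact ⟨T.idealizer, inferInstance, ⟨T.globalization⟩⟩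
end

section
/- Let 𝒢 be a finite groupoid, R a unital ring, α a globalizable twisted partial action of 𝒢 on R, and β a globalization of α acting on a ring T. Then the rings A = R ⋊_{α,w} 𝒢 and B = T ⋊_{β,u} 𝒢 are Morita equivalent (there is a Morita context (A, B, M, N, τ, τ') with τ and τ' surjective; in particular the module categories of A and B are equivalent). -/
attribute [local instance] Classical.propDecidable

universe u v w

/-- The finitely supported functions whose value at each `g` lies in `S g`. -/
def finsuppValued {G : Type u} {R : Type v} [NonUnitalRing R] (S : G → AddSubgroup R) :
    AddSubgroup (G →₀ R) where
  carrier := {f | ∀ g, f g ∈ S g}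
  zero_mem' g := (S g).zero_mem
  add_mem' hf hf' g := (S g).add_mem (hf g) (hf' g)
  neg_mem' hf g := (S g).neg_mem (hf g)

section finsuppValued

variable {G : Type u} {R : Type v} [NonUnitalRing R] {S : G → AddSubgroup R}

theorem single_mem_finsuppValued {g : G} {a : R} (ha : a ∈ S g) :
    Finsupp.single g a ∈ finsuppValued S := by
  intro k
  rw [Finsupp.single_apply]
  split_ifs with h
  · exact h ▸ ha
  · exact (S k).zero_mem

theorem finsuppValued_induction {p : (G →₀ R) → Prop} (zero : p 0)
    (add : ∀ f ∈ finsuppValued S, ∀ f' ∈ finsuppValued S, p f → p f' → p (f + f'))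
    (single : ∀ g, ∀ a ∈ S g, p (Finsupp.single g a))
    {f : G →₀ R} (hf : f ∈ finsuppValued S) : p f := by
  have key : f.sum Finsupp.single ∈ finsuppValued S ∧ p (f.sum Finsupp.single) :=
    Finset.sum_induction _ (fun f => f ∈ finsuppValued S ∧ p f)
      (fun a b ha hb => ⟨add_mem ha.1 hb.1, add a ha.1 b hb.1 ha.2 hb.2⟩)
      ⟨zero_mem _, zero⟩
      (fun g _ => ⟨single_mem_finsuppValued (hf g), single g _ (hf g)⟩)
  rw [Finsupp.sum_single] at key
  exact key.2

end finsuppValued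

namespace RingTPA

variable {G : Type u} {R : Type v} [NonUnitalRing R] {gd : PGroupoid G} (B : RingTPA gd R)

theorem act_mem_s3 {g : G} {a : R} (ha : a ∈ B.D (gd.inv g)) : B.act g a ∈ B.D g :=
  (B.act_bij g).mapsTo ha

theorem act_zero (g : G) : B.act g 0 = 0 := by
  simpa using B.act_add g 0 (zero_mem _) 0 (zero_mem _)

theorem actinv_zero (g : G) : B.actinv g 0 = 0 := by
  simpa [B.act_zero] using B.actinv_act g 0 (zero_mem _)

theorem act_neg {g : G} {a : R} (ha : a ∈ B.D (gd.inv g)) : B.act g (-a) = -B.act g a := by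
  have h := B.act_add g (-a) (neg_mem ha) a ha
  rw [neg_add_cancel, B.act_zero] at h
  exact eq_neg_of_add_eq_zero_left h.symm

/-- The image under `B.act g` of an additive subgroup of its domain. -/
def actImage (g : G) (I : AddSubgroup R) (hI : I ≤ B.D (gd.inv g)) : AddSubgroup R where
  carrier := B.act g '' I
  zero_mem' := ⟨0, I.zero_mem, B.act_zero g⟩
  add_mem' := by
    rintro _ _ ⟨a, ha, rfl⟩ ⟨b, hb, rfl⟩
    exact ⟨a + b, I.add_mem ha hb, B.act_add g a (hI ha) b (hI hb)⟩
  neg_mem' := by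
    rintro _ ⟨a, ha, rfl⟩
    exact ⟨-a, I.neg_mem ha, B.act_neg (hI ha)⟩

theorem actImage_le (g : G) (I : AddSubgroup R) (hI : I ≤ B.D (gd.inv g)) :
    B.actImage g I hI ≤ B.D g := by
  rintro _ ⟨a, ha, rfl⟩
  exact B.act_mem_s3 (hI ha)

theorem mul_mem_actImage {g : G} {I : AddSubgroup R} {hI : I ≤ B.D (gd.inv g)}
    (hideal : ∀ r : R, ∀ x ∈ I, r * x ∈ I ∧ x * r ∈ I) {r x : R} (hr : r ∈ B.D g)
    (hx : x ∈ B.actImage g I hI) :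
    r * x ∈ B.actImage g I hI ∧ x * r ∈ B.actImage g I hI := by
  obtain ⟨a, ha, rfl⟩ := hx
  obtain ⟨s, hs, rfl⟩ := (B.act_bij g).surjOn hr
  exact ⟨⟨s * a, (hideal s a ha).1, B.act_mul g s hs a (hI ha)⟩,
    ⟨a * s, (hideal s a ha).2, B.act_mul g a (hI ha) s hs⟩⟩

theorem cpMul_single_single (g h : G) (a b : R) :
    cpMul gd B (Finsupp.single g a) (Finsupp.single h b) =
      if gd.comp g h then
        Finsupp.single (gd.mul g h) (B.act g (B.actinv g a * b) * B.w g h) else 0 := by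
  unfold cpMul
  rw [Finsupp.sum_single_index, Finsupp.sum_single_index]
  · simp [B.act_zero]
  · simp [B.act_zero, B.actinv_zero]

theorem cpMul_zero_left (f : G →₀ R) : cpMul gd B 0 f = 0 := by
  simp [cpMul]

theorem cpMul_zero_right (f : G →₀ R) : cpMul gd B f 0 = 0 := by
  simp [cpMul]

theorem cpMul_mem_finsuppValued {P Q S : G → AddSubgroup R}
    (hPQ : ∀ g h, gd.comp g h → ∀ a ∈ P g, ∀ b ∈ Q h,
      B.act g (B.actinv g a * b) * B.w g h ∈ S (gd.mul g h))
    {f f' : G →₀ R} (hf : f ∈ finsuppValued P) (hf' : f' ∈ finsuppValued Q) :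
    cpMul gd B f f' ∈ finsuppValued S := by
  refine sum_mem fun g _ => sum_mem fun h _ => ?_
  dsimp only
  split_ifs with c
  · exact single_mem_finsuppValued (hPQ g h c _ (hf g) _ (hf' h))
  · exact zero_mem _

theorem cpMul_eq_sum [Fintype G] (f f' : G →₀ R) :
    cpMul gd B f f' = ∑ g, ∑ h, if gd.comp g h then
      Finsupp.single (gd.mul g h) (B.act g (B.actinv g (f g) * f' h) * B.w g h) else 0 := by
  unfold cpMul
  rw [Finsupp.sum_fintype]
  · refine Finset.sum_congr rfl fun g _ => ?_
    rw [Finsupp.sum_fintype]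
    intro h
    simp [B.act_zero]
  · intro g
    simp [B.act_zero, B.actinv_zero]

/-- A twisted partial action is global when each `D g` is the whole `D (tgt g)`. -/
def IsGlobal : Prop := ∀ g, B.D g = B.D (gd.tgt g)

namespace IsGlobal

variable {B}

theorem D_congr (hB : B.IsGlobal) {g h : G} (e : gd.tgt g = gd.tgt h) : B.D g = B.D h := by
  rw [hB g, hB h, e]

theorem D_inv (hB : B.IsGlobal) {g h : G} (c : gd.comp g h) : B.D (gd.inv g) = B.D h :=
  hB.D_congr (by rw [gd.tgt_inv, (gd.comp_iff g h).1 c])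

theorem D_mul (hB : B.IsGlobal) {g h : G} (c : gd.comp g h) : B.D (gd.mul g h) = B.D g :=
  hB.D_congr (gd.tgt_mul g h c)

theorem D_inv_mul (hB : B.IsGlobal) {g h : G} (c : gd.comp g h) :
    B.D (gd.inv (gd.mul g h)) = B.D (gd.inv h) :=
  hB.D_congr (by rw [gd.tgt_inv, gd.tgt_inv, gd.src_mul g h c])

theorem mul_mem (hB : B.IsGlobal) {g : G} (r : R) {x : R} (hx : x ∈ B.D g) : r * x ∈ B.D g := by
  rw [hB g] at hx ⊢
  exact (B.ideal_top g r x hx).1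

theorem mul_mem_right (hB : B.IsGlobal) {g : G} (r : R) {x : R} (hx : x ∈ B.D g) :
    x * r ∈ B.D g := by
  rw [hB g] at hx ⊢
  exact (B.ideal_top g r x hx).2

theorem setMulAdd_eq (hB : B.IsGlobal) {g h : G} (e : gd.tgt g = gd.tgt h) :
    setMulAdd (B.D g : Set R) (B.D h : Set R) = B.D g := by
  rw [← hB.D_congr e, B.sq]

theorem w_winv_mem (hB : B.IsGlobal) {g h : G} (c : gd.comp g h) {x : R} (hx : x ∈ B.D g) :
    B.w g h * (B.winv g h * x) = x ∧ B.winv g h * (B.w g h * x) = x ∧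
      (x * B.w g h) * B.winv g h = x ∧ (x * B.winv g h) * B.w g h = x :=
  B.w_winv g h c x (by rwa [hB.setMulAdd_eq (gd.tgt_mul g h c).symm])

theorem act_actinv_mul (hB : B.IsGlobal) {g h : G} (c : gd.comp g h) {a b : R} (ha : a ∈ B.D g)
    (hb : b ∈ B.D h) : B.act g (B.actinv g a * b) = a * B.act g b := by
  rw [B.act_mul g _ (B.actinv_mem g a ha) b (by rwa [hB.D_inv c]), B.act_actinv g a ha]

theorem act_act_mul_w (hB : B.IsGlobal) {g h : G} (c : gd.comp g h) {x : R}
    (hx : x ∈ B.D (gd.inv h)) :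
    B.act g (B.act h x) * B.w g h = B.w g h * B.act (gd.mul g h) x := by
  have hm : B.act (gd.mul g h) x ∈ B.D g := by
    rw [← hB.D_mul c]
    exact B.act_mem_s3 (by rwa [hB.D_inv_mul c])
  rw [B.act_act g h c x, (hB.w_winv_mem c (hB.mul_mem _ hm)).2.2.2]
  rw [← gd.inv_mul_rev g h c, hB.setMulAdd_eq]
  · exact hx
  · rw [gd.tgt_inv, gd.tgt_inv, gd.src_mul g h c]

theorem w_cocycle_mem (hB : B.IsGlobal) {g h k : G} (c : gd.comp g h) (c' : gd.comp h k) {a : R}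
    (ha : a ∈ B.D h) :
    B.act g (a * B.w h k) * B.w g (gd.mul h k) = B.act g a * B.w g h * B.w (gd.mul g h) k := by
  refine B.w_cocycle g h k c c' a ?_
  rw [hB.D_inv c, B.sq, hB.setMulAdd_eq (gd.tgt_mul h k c').symm]
  exact ha

theorem coeff_mem (hB : B.IsGlobal) {g h : G} (c : gd.comp g h) {a b : R} (ha : a ∈ B.D g)
    (hb : b ∈ B.D h) : B.act g (B.actinv g a * b) * B.w g h ∈ B.D (gd.mul g h) := by
  rw [hB.act_actinv_mul c ha hb, hB.D_mul c, mul_assoc]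
  exact hB.mul_mem_right _ ha

theorem coeff_act (hB : B.IsGlobal) {g h : G} (c : gd.comp g h) {a x : R} (ha : a ∈ B.D g)
    (hx : x ∈ B.D (gd.inv h)) :
    B.act g (B.actinv g a * B.act h x) * B.w g h =
      a * B.w g h * B.act (gd.mul g h) x := by
  rw [hB.act_actinv_mul c ha (B.act_mem_s3 hx), mul_assoc, hB.act_act_mul_w c hx, mul_assoc]

theorem cpMul_mem (hB : B.IsGlobal) {f f' : G →₀ R} (hf : f ∈ finsuppValued B.D)
    (hf' : f' ∈ finsuppValued B.D) : cpMul gd B f f' ∈ finsuppValued B.D :=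
  B.cpMul_mem_finsuppValued (fun _ _ c _ ha _ hb => hB.coeff_mem c ha hb) hf hf'

theorem cpMul_add_left [Fintype G] (hB : B.IsGlobal) {f₁ f₂ f : G →₀ R}
    (h₁ : f₁ ∈ finsuppValued B.D) (h₂ : f₂ ∈ finsuppValued B.D) (hf : f ∈ finsuppValued B.D) :
    cpMul gd B (f₁ + f₂) f = cpMul gd B f₁ f + cpMul gd B f₂ f := by
  simp only [cpMul_eq_sum, ← Finset.sum_add_distrib]
  refine Finset.sum_congr rfl fun g _ => Finset.sum_congr rfl fun h _ => ?_
  split_ifs with c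
  · rw [← Finsupp.single_add, Finsupp.add_apply,
      hB.act_actinv_mul c (add_mem (h₁ g) (h₂ g)) (hf h), hB.act_actinv_mul c (h₁ g) (hf h),
      hB.act_actinv_mul c (h₂ g) (hf h), add_mul, add_mul]
  · rw [add_zero]

theorem cpMul_add_right [Fintype G] (hB : B.IsGlobal) {f f₁ f₂ : G →₀ R}
    (hf : f ∈ finsuppValued B.D) (h₁ : f₁ ∈ finsuppValued B.D) (h₂ : f₂ ∈ finsuppValued B.D) :
    cpMul gd B f (f₁ + f₂) = cpMul gd B f f₁ + cpMul gd B f f₂ := by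
  simp only [cpMul_eq_sum, ← Finset.sum_add_distrib]
  refine Finset.sum_congr rfl fun g _ => Finset.sum_congr rfl fun h _ => ?_
  split_ifs with c
  · rw [← Finsupp.single_add, Finsupp.add_apply,
      hB.act_actinv_mul c (hf g) (add_mem (h₁ h) (h₂ h)), hB.act_actinv_mul c (hf g) (h₁ h),
      hB.act_actinv_mul c (hf g) (h₂ h), ← add_mul, ← mul_add,
      B.act_add g _ (by rw [hB.D_inv c]; exact h₁ h) _ (by rw [hB.D_inv c]; exact h₂ h)]
  · rw [add_zero]

theorem cpMul_assoc_single (hB : B.IsGlobal) {g h k : G} {a b x : R} (ha : a ∈ B.D g)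
    (hb : b ∈ B.D h) (hx : x ∈ B.D k) :
    cpMul gd B (cpMul gd B (Finsupp.single g a) (Finsupp.single h b)) (Finsupp.single k x) =
      cpMul gd B (Finsupp.single g a) (cpMul gd B (Finsupp.single h b) (Finsupp.single k x)) := by
  rw [cpMul_single_single, cpMul_single_single]
  by_cases c : gd.comp g h <;> by_cases c' : gd.comp h k
  · have c₁ : gd.comp (gd.mul g h) k := by
      rw [gd.comp_iff, gd.src_mul g h c, ← gd.comp_iff]; exact c'
    have c₂ : gd.comp g (gd.mul h k) := by
      rw [gd.comp_iff, gd.tgt_mul h k c', ← gd.comp_iff]; exact c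
    have hx' : x ∈ B.D (gd.inv h) := by rwa [hB.D_inv c']
    have hb' : b ∈ B.D (gd.inv g) := by rwa [hB.D_inv c]
    have hhx : B.act h x ∈ B.D (gd.inv g) := by
      rw [hB.D_inv c]; exact B.act_mem_s3 hx'
    rw [if_pos c, if_pos c', cpMul_single_single, cpMul_single_single, if_pos c₁, if_pos c₂,
      gd.mul_assoc' g h k c c', hB.act_actinv_mul c₁ (hB.coeff_mem c ha hb) hx,
      hB.act_actinv_mul c₂ ha (hB.coeff_mem c' hb hx), hB.act_actinv_mul c ha hb,
      hB.act_actinv_mul c' hb hx,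
      mul_assoc a (B.act g (b * B.act h x * B.w h k)),
      hB.w_cocycle_mem c c' (hB.mul_mem_right _ hb),
      B.act_mul g b hb' _ hhx, mul_assoc (B.act g b), hB.act_act_mul_w c hx']
    simp only [mul_assoc]
  · have c₁ : ¬ gd.comp (gd.mul g h) k := by
      rw [gd.comp_iff, gd.src_mul g h c, ← gd.comp_iff]; exact c'
    rw [if_pos c, if_neg c', cpMul_single_single, if_neg c₁, cpMul_zero_right]
  · have c₂ : ¬ gd.comp g (gd.mul h k) := by
      rw [gd.comp_iff, gd.tgt_mul h k c', ← gd.comp_iff]; exact c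
    rw [if_neg c, if_pos c', cpMul_single_single, if_neg c₂, cpMul_zero_left]
  · rw [if_neg c, if_neg c', cpMul_zero_left, cpMul_zero_right]

theorem cpMul_assoc [Fintype G] (hB : B.IsGlobal) {f f' f'' : G →₀ R}
    (hf : f ∈ finsuppValued B.D) (hf' : f' ∈ finsuppValued B.D) (hf'' : f'' ∈ finsuppValued B.D) :
    cpMul gd B (cpMul gd B f f') f'' = cpMul gd B f (cpMul gd B f' f'') := by
  refine finsuppValued_induction (p := fun F => cpMul gd B (cpMul gd B F f') f'' =
    cpMul gd B F (cpMul gd B f' f'')) ?_ ?_ ?_ hf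
  · simp only [cpMul_zero_left]
  · intro f₁ h₁ f₂ h₂ e₁ e₂
    rw [hB.cpMul_add_left h₁ h₂ hf', hB.cpMul_add_left (hB.cpMul_mem h₁ hf')
      (hB.cpMul_mem h₂ hf') hf'', hB.cpMul_add_left h₁ h₂ (hB.cpMul_mem hf' hf''), e₁, e₂]
  intro g a ha
  have hga := single_mem_finsuppValued (S := B.D) ha
  refine finsuppValued_induction (p := fun F => cpMul gd B (cpMul gd B (Finsupp.single g a) F) f'' =
    cpMul gd B (Finsupp.single g a) (cpMul gd B F f'')) ?_ ?_ ?_ hf'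
  · simp only [cpMul_zero_left, cpMul_zero_right]
  · intro f₁ h₁ f₂ h₂ e₁ e₂
    rw [hB.cpMul_add_right hga h₁ h₂, hB.cpMul_add_left (hB.cpMul_mem hga h₁)
      (hB.cpMul_mem hga h₂) hf'', hB.cpMul_add_left h₁ h₂ hf'',
      hB.cpMul_add_right hga (hB.cpMul_mem h₁ hf'') (hB.cpMul_mem h₂ hf''), e₁, e₂]
  intro h b hb
  have hhb := single_mem_finsuppValued (S := B.D) hb
  refine finsuppValued_induction (p := fun F => cpMul gd B (cpMul gd B (Finsupp.single g a) (Finsupp.single h b)) F =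
    cpMul gd B (Finsupp.single g a) (cpMul gd B (Finsupp.single h b) F)) ?_ ?_ ?_ hf''
  · simp only [cpMul_zero_right]
  · intro f₁ h₁ f₂ h₂ e₁ e₂
    rw [hB.cpMul_add_right (hB.cpMul_mem hga hhb) h₁ h₂, hB.cpMul_add_right hhb h₁ h₂,
      hB.cpMul_add_right hga (hB.cpMul_mem hhb h₁) (hB.cpMul_mem hhb h₂), e₁, e₂]
  intro k x hx
  exact hB.cpMul_assoc_single ha hb hx

end IsGlobal

end RingTPA

/-- Let `gd` be a finite groupoid, `R` a unital ring (realized here as the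
unital ideal `R₀` of `T` containing all the `D_e`), `A` a globalizable twisted partial action
of `gd` on `R` and `B` a globalization of `A` acting on `T` (identification as above).  Then
the crossed products `A = R ⋊_{α,w} 𝒢` and `B = T ⋊_{β,u} 𝒢` are Morita equivalent: there
is a Morita context `(A, B, M, N, τ, τ')` — with `M`, `N` sub-bimodules of `B` and `τ`, `τ'`
given by multiplication — in which `τ` and `τ'` are surjective. -/
theorem statement3 {G : Type u} {T : Type v} [NonUnitalRing T] [Fintype G]
    (gd : PGroupoid G) (B : RingTPA gd T)
    (hglobal : ∀ g, B.D g = B.D (gd.tgt g))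
    (A : RingTPA gd T)
    (hsub : ∀ e, gd.isId e → A.D e ≤ B.D e)
    (hideal : ∀ e, gd.isId e → ∀ s ∈ B.D e, ∀ x ∈ A.D e, s * x ∈ A.D e ∧ x * s ∈ A.D e)
    (hact : ∀ g, ∀ a ∈ A.D (gd.inv g), A.act g a = B.act g a)
    (hactinv : ∀ g, ∀ a ∈ A.D g, A.actinv g a = B.actinv g a)
    (hcap : ∀ g, (A.D g : Set T) =
        ((A.D (gd.tgt g) : Set T)) ∩ (B.act g '' ((A.D (gd.src g) : Set T))))
    (hsum : ∀ g, B.D g = AddSubgroup.closure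
        (⋃ h ∈ {h : G | gd.tgt h = gd.tgt g}, B.act h '' ((A.D (gd.src h) : Set T))))
    (hw : ∀ g h, gd.comp g h →
        ∀ a ∈ setMulAdd ((A.D g : Set T)) ((A.D (gd.mul g h) : Set T)),
        a * A.w g h = a * B.w g h ∧ A.w g h * a = B.w g h * a)
    (one : G → T) (hone_mem : ∀ g, one g ∈ A.D g)
    (hone : ∀ g, ∀ x ∈ A.D g, one g * x = x ∧ x * one g = x)
    (G0 : Finset G) (hG0 : ∀ e, e ∈ G0 ↔ gd.isId e)
    (oneA : G →₀ T) (honeA : oneA = G0.sum fun e => Finsupp.single e (one e))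
    (R₀ : AddSubgroup T) (hR₀ : ∀ e, gd.isId e → A.D e ≤ R₀)
    (oneR : T) (honeR : oneR ∈ R₀ ∧ ∀ x ∈ R₀, oneR * x = x ∧ x * oneR = x) :
    ∃ M N : AddSubgroup (G →₀ T),
      (∀ m ∈ M, ∀ g, (m : G →₀ T) g ∈ B.D g) ∧
      (∀ n ∈ N, ∀ g, (n : G →₀ T) g ∈ B.D g) ∧
      (∀ f : G →₀ T, (∀ g, f g ∈ A.D g) → ∀ m ∈ M, cpMul gd B f m ∈ M) ∧
      (∀ m ∈ M, ∀ f : G →₀ T, (∀ g, f g ∈ B.D g) → cpMul gd B m f ∈ M) ∧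
      (∀ f : G →₀ T, (∀ g, f g ∈ B.D g) → ∀ n ∈ N, cpMul gd B f n ∈ N) ∧
      (∀ n ∈ N, ∀ f : G →₀ T, (∀ g, f g ∈ A.D g) → cpMul gd B n f ∈ N) ∧
      (∀ m ∈ M, ∀ n ∈ N, ∀ g, (cpMul gd B m n) g ∈ A.D g) ∧
      (∀ m ∈ M, ∀ n ∈ N, ∀ m' ∈ M,
          cpMul gd B (cpMul gd B m n) m' = cpMul gd B m (cpMul gd B n m')) ∧
      (∀ n ∈ N, ∀ m ∈ M, ∀ n' ∈ N,
          cpMul gd B (cpMul gd B n m) n' = cpMul gd B n (cpMul gd B m n')) ∧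
      (∀ f : G →₀ T, (∀ g, f g ∈ A.D g) →
          f ∈ AddSubgroup.closure {y : G →₀ T | ∃ m ∈ M, ∃ n ∈ N, y = cpMul gd B m n}) ∧
      (∀ f : G →₀ T, (∀ g, f g ∈ B.D g) →
          f ∈ AddSubgroup.closure {y : G →₀ T | ∃ n ∈ N, ∃ m ∈ M, y = cpMul gd B n m}) := by
  have hB : B.IsGlobal := hglobal
  have hAD (g : G) : A.D g ≤ B.D g := by
    rw [hB g]
    exact (A.sub g).trans (hsub _ (gd.tgt_tgt g))
  have hAtgt (g h : G) (c : gd.comp g h) : A.D (gd.src g) = A.D (gd.tgt h) := by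
    rw [(gd.comp_iff g h).1 c]
  have hsrc_le (g : G) : A.D (gd.src g) ≤ B.D (gd.inv g) := by
    rw [hB.D_congr (h := gd.src g) (by rw [gd.tgt_inv, gd.tgt_src])]
    exact hAD _
  have hAid (g : G) (r x : T) (hx : x ∈ A.D (gd.src g)) :
      r * x ∈ A.D (gd.src g) ∧ x * r ∈ A.D (gd.src g) := by
    rw [← gd.tgt_src] at hx ⊢
    exact A.ideal_top _ r x hx
  let P : G → AddSubgroup T := fun g => A.D (gd.tgt g)
  let Q : G → AddSubgroup T := fun g => B.actImage g (A.D (gd.src g)) (hsrc_le g)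
  have hP (g : G) : P g ≤ B.D g := by
    rw [hB g]
    exact hAD _
  have hQ (g : G) : Q g ≤ B.D g := B.actImage_le _ _ _
  have hPQ (g : G) (x : T) : x ∈ A.D g ↔ x ∈ P g ∧ x ∈ Q g := Set.ext_iff.1 (hcap g) x
  have hQid {g : G} {r x : T} (hr : r ∈ B.D g) (hx : x ∈ Q g) : r * x ∈ Q g ∧ x * r ∈ Q g :=
    B.mul_mem_actImage (hAid g) hr hx
  -- Multiplying on the right by an element of `Q` lands in `Q`.
  have hBQ {g h : G} (c : gd.comp g h) {a b : T} (ha : a ∈ B.D g) (hb : b ∈ Q h) :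
      B.act g (B.actinv g a * b) * B.w g h ∈ Q (gd.mul g h) := by
    obtain ⟨x, hx, rfl⟩ := hb
    rw [hB.coeff_act c ha (hsrc_le h hx)]
    refine (hQid ?_ ⟨x, ?_, rfl⟩).1
    · rw [hB.D_mul c]
      exact hB.mul_mem_right _ ha
    · rw [gd.src_mul g h c]
      exact hx
  -- Multiplying on the left by an element of `P` lands in `P`.
  have hPB {g h : G} (c : gd.comp g h) {a b : T} (ha : a ∈ P g) (hb : b ∈ B.D h) :
      B.act g (B.actinv g a * b) * B.w g h ∈ P (gd.mul g h) := by
    rw [hB.act_actinv_mul c (hP g ha) hb, mul_assoc]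
    change _ ∈ A.D (gd.tgt (gd.mul g h))
    rw [gd.tgt_mul g h c]
    exact (A.ideal_top g _ a ha).2
  refine ⟨finsuppValued P, finsuppValued Q, fun m hm g => hP g (hm g), fun n hn g => hQ g (hn g),
    ?_, ?_, ?_, ?_, ?_, ?_, ?_, ?_, ?_⟩
  · intro f hf m hm
    exact B.cpMul_mem_finsuppValued (P := A.D)
      (fun g h c a ha b hb => hPB c ((hPQ g a).1 ha).1 (hP h hb)) hf hm
  · intro m hm f hf
    exact B.cpMul_mem_finsuppValued (Q := B.D) (fun g h c a ha b hb => hPB c ha hb) hm hf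
  · intro f hf n hn
    exact B.cpMul_mem_finsuppValued (P := B.D) (fun g h c a ha b hb => hBQ c ha hb) hf hn
  · intro n hn f hf
    exact B.cpMul_mem_finsuppValued (Q := A.D)
      (fun g h c a ha b hb => hBQ c (hQ g ha) ((hPQ h b).1 hb).2) hn hf
  · intro m hm n hn
    exact B.cpMul_mem_finsuppValued (S := A.D) (fun g h c a ha b hb =>
      (hPQ _ _).2 ⟨hPB c ha (hQ h hb), hBQ c (hP g ha) hb⟩) hm hn
  · intro m hm n hn m' hm'
    exact hB.cpMul_assoc (fun g => hP g (hm g)) (fun g => hQ g (hn g)) (fun g => hP g (hm' g))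
  · intro n hn m hm n' hn'
    exact hB.cpMul_assoc (fun g => hQ g (hn g)) (fun g => hP g (hm g)) (fun g => hQ g (hn' g))
  · intro f hf
    refine finsuppValued_induction (S := A.D) (zero_mem _) (fun _ _ _ _ => add_mem) ?_ hf
    intro g a ha
    have hone_P : one (gd.tgt g) ∈ P (gd.tgt g) := by
      change _ ∈ A.D (gd.tgt (gd.tgt g))
      rw [gd.tgt_tgt]
      exact hone_mem _
    have haB : a ∈ B.D (gd.tgt g) := hB g ▸ hAD g ha
    refine AddSubgroup.subset_closure ⟨_, single_mem_finsuppValued hone_P, _,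
      single_mem_finsuppValued ((hPQ g a).1 ha).2, ?_⟩
    rw [B.cpMul_single_single, if_pos (gd.comp_tgt_self g), gd.tgt_mul_self,
      hB.act_actinv_mul (gd.comp_tgt_self g) (hP _ hone_P) (hAD g ha),
      B.act_id _ (gd.tgt_tgt g) a haB, (hone _ a (A.sub g ha)).1,
      (B.w_id_left g a (hAD g ha)).2]
  · intro f hf
    refine finsuppValued_induction (S := B.D) (zero_mem _) (fun _ _ _ _ => add_mem) ?_ hf
    intro g b hb
    rw [hsum g] at hb
    induction hb using AddSubgroup.closure_induction with
    | zero => rw [Finsupp.single_zero]; exact zero_mem _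
    | add x y _ _ hx hy => rw [Finsupp.single_add]; exact add_mem hx hy
    | neg x _ hx => rw [Finsupp.single_neg]; exact neg_mem hx
    | mem b hb =>
      simp only [Set.mem_iUnion, Set.mem_ofPred_eq] at hb
      obtain ⟨h, htgt, x, hx, rfl⟩ := hb
      -- Write `act h x δ_g` as a product `(act h x δ_h) (y δ_{h⁻¹g})`.
      set k := gd.mul (gd.inv h) g with hk
      have c₀ : gd.comp (gd.inv h) g := by rw [gd.comp_iff, gd.src_inv, htgt]
      have c : gd.comp h k := by
        rw [gd.comp_iff, hk, gd.tgt_mul _ _ c₀, gd.tgt_inv]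
      have hmul : gd.mul h k = g := by
        rw [hk, ← gd.mul_assoc' _ _ _ (gd.comp_inv_right h) c₀, gd.mul_inv_self, htgt,
          gd.tgt_mul_self]
      set e := one (gd.src h) with he
      have he_mem : e ∈ A.D (gd.src h) := hone_mem _
      have hxB := hsrc_le h hx
      have heB := hsrc_le h he_mem
      have hxe : x * e = x := (hone _ x hx).2
      set y := B.actinv h (B.act h e * B.winv h k) with hy
      have hew : B.act h e * B.winv h k ∈ B.D h := hB.mul_mem_right _ (B.act_mem_s3 heB)
      have hyB : y ∈ B.D (gd.inv h) := B.actinv_mem h _ hew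
      have hy_act : B.act h y = B.act h e * B.winv h k := B.act_actinv h _ hew
      have hey : e * y = y := by
        refine (B.act_bij h).injOn (hB.mul_mem _ hyB) hyB ?_
        rw [B.act_mul h e heB y hyB, hy_act, ← mul_assoc, ← B.act_mul h e heB e heB,
          (hone _ e he_mem).1]
      have hyP : y ∈ P k := by
        change y ∈ A.D (gd.tgt k)
        rw [← hAtgt h k c, ← hey]
        exact (hAid h y e he_mem).2
      refine AddSubgroup.subset_closure ⟨_, single_mem_finsuppValued (g := h) ⟨x, hx, rfl⟩, _,
        single_mem_finsuppValued hyP, ?_⟩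
      rw [B.cpMul_single_single, if_pos c, hmul, hB.act_actinv_mul c (B.act_mem_s3 hxB) (hP k hyP),
        hy_act, ← mul_assoc, ← B.act_mul h x hxB e heB, hxe,
        (hB.w_winv_mem c (B.act_mem_s3 hxB)).2.2.2]
end

section
/- Let 𝔠 be a category and 𝕂 a field. The semilattice b(𝔠) of idempotents of the factor-set semigroup m(𝔠), the semilattice B(𝔠) of idempotents of the partial Schur multiplier M(𝔠) = m(𝔠)/∼, and the semilattice Y(𝔠) of all ideals of 𝔠 (including the empty set) under union, are pairwise isomorphic as semilattices. -/
attribute [local instance] Classical.propDecidable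

universe u v w

/-- An (algebraic) category: a semigroupoid in which every element `x` has identities
`tgt x` (= `r(x)`) and `src x` (= `d(x)`), a product `mul x y` being defined precisely
when `comp x y`, i.e. `src x = tgt y`. -/
structure PCategory (C : Type u) where
  mul : C → C → C
  src : C → C
  tgt : C → C
  comp : C → C → Prop
  comp_iff : ∀ x y, comp x y ↔ src x = tgt y
  mul_assoc' : ∀ x y z, comp x y → comp y z → mul (mul x y) z = mul x (mul y z)
  src_mul : ∀ x y, comp x y → src (mul x y) = src y
  tgt_mul : ∀ x y, comp x y → tgt (mul x y) = tgt x
  tgt_mul_self : ∀ x, mul (tgt x) x = x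
  mul_src_self : ∀ x, mul x (src x) = x
  comp_tgt_self : ∀ x, comp (tgt x) x
  comp_src_self : ∀ x, comp x (src x)
  tgt_tgt : ∀ x, tgt (tgt x) = tgt x
  src_tgt : ∀ x, src (tgt x) = tgt x
  tgt_src : ∀ x, tgt (src x) = src x
  src_src : ∀ x, src (src x) = src x

/-- A (two-sided) ideal of the semigroupoid. -/
def PCategory.IsIdeal {C : Type u} (cc : PCategory C) (I : Set C) : Prop :=
  ∀ x y, cc.comp x y → (x ∈ I ∨ y ∈ I) → cc.mul x y ∈ I

/-- The data of a `𝕂`-semigroup: a multiplication, a zero and a `𝕂`-action. -/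
structure KSgStr (K : Type v) (S : Type w) where
  mul : S → S → S
  zero : S
  smul : K → S → S

/-- `M` is a `𝕂`-semigroup: a semigroup with zero together with a `𝕂`-action such that
`α(βx) = (αβ)x`, `1x = x`, `α(xy) = (αx)y = x(αy)` and `0_𝕂 x = 0`. -/
def KSgStr.IsKSemigroup {K : Type v} {S : Type w} [Field K] (M : KSgStr K S) : Prop :=
  (∀ x y z : S, M.mul (M.mul x y) z = M.mul x (M.mul y z)) ∧
  (∀ x : S, M.mul M.zero x = M.zero) ∧
  (∀ x : S, M.mul x M.zero = M.zero) ∧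
  (∀ (a b : K) (x : S), M.smul a (M.smul b x) = M.smul (a * b) x) ∧
  (∀ x : S, M.smul 1 x = x) ∧
  (∀ (a : K) (x y : S), M.mul (M.smul a x) y = M.smul a (M.mul x y)) ∧
  (∀ (a : K) (x y : S), M.mul x (M.smul a y) = M.smul a (M.mul x y)) ∧
  (∀ x : S, M.smul 0 x = M.zero)

/-- `M` is `𝕂`-cancellative: `αx = βx` with `x ≠ 0` implies `α = β`. -/
def KSgStr.IsKCancellative {K : Type v} {S : Type w} [Field K] (M : KSgStr K S) : Prop :=
  ∀ (a b : K) (x : S), x ≠ M.zero → M.smul a x = M.smul b x → a = b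

/-- A projective representation of the category `cc` on the `𝕂`-cancellative semigroup `M`,
with factor set `ρ`: if `xy` is defined then `Γ(xy) = 0 ↔ Γ(x)Γ(y) = 0`, if `xy` is
undefined then `Γ(x)Γ(y) = 0`; `ρ` is nonzero exactly on the composable pairs with
`Γ(xy) ≠ 0`, and there `Γ(x)Γ(y) = ρ(x,y)·Γ(xy)`. -/
def IsProjRep {C : Type u} {K : Type v} {S : Type w} [Field K]
    (cc : PCategory C) (M : KSgStr K S) (Γ : C → S) (ρ : C → C → K) : Prop :=
  (∀ x y, cc.comp x y → (Γ (cc.mul x y) = M.zero ↔ M.mul (Γ x) (Γ y) = M.zero)) ∧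
  (∀ x y, ¬ cc.comp x y → M.mul (Γ x) (Γ y) = M.zero) ∧
  (∀ x y, ρ x y ≠ 0 ↔ (cc.comp x y ∧ Γ (cc.mul x y) ≠ M.zero)) ∧
  (∀ x y, cc.comp x y → Γ (cc.mul x y) ≠ M.zero →
      M.mul (Γ x) (Γ y) = M.smul (ρ x y) (Γ (cc.mul x y)))

/-- `ρ` is a factor set of the category `cc` over `𝕂`: it is the factor set of some
projective representation of `cc` on some `𝕂`-cancellative semigroup. -/
def IsFactorSet {C : Type u} {K : Type v} [Field K]
    (cc : PCategory C) (ρ : C → C → K) : Prop :=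
  ∃ (S : Type (max u v)) (M : KSgStr K S), M.IsKSemigroup ∧ M.IsKCancellative ∧
    ∃ Γ : C → S, IsProjRep cc M Γ ρ


/-- The idempotent elements of the semigroup `m(cc)` of factor sets of `cc`
(pointwise multiplication). -/
def IdemFS {C : Type u} (K : Type v) [Field K] (cc : PCategory C) :=
  {ε : C → C → K // IsFactorSet cc ε ∧ ∀ x y, ε x y * ε x y = ε x y}

/-- The ideals of the semigroupoid `cc` (the semilattice `Y(cc)` under union). -/
def IdealSub {C : Type u} (cc : PCategory C) := {I : Set C // cc.IsIdeal I}

/-- The semigroup `m(cc)` of factor sets of `cc`. -/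
def FS {C : Type u} (K : Type v) [Field K] (cc : PCategory C) :=
  {ρ : C → C → K // IsFactorSet cc ρ}

/-- Equivalence of factor sets: `ρ ∼ σ` iff there is `ν : C → 𝕂*` with
`ρ(x,y) = ν(x)ν(xy)⁻¹ν(y)σ(x,y)` whenever `xy` is defined, and `ρ(x,y) = σ(x,y) = 0`
when `xy` is undefined. -/
def FSrel {C : Type u} {K : Type v} [Field K] (cc : PCategory C)
    (ρ σ : FS K cc) : Prop :=
  ∃ ν : C → Kˣ,
    (∀ x y, cc.comp x y →
      ρ.1 x y = (ν x : K) * ((ν (cc.mul x y) : K))⁻¹ * (ν y : K) * σ.1 x y) ∧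
    (∀ x y, ¬ cc.comp x y → ρ.1 x y = 0 ∧ σ.1 x y = 0)

/-- The partial Schur multiplier `M(cc) = m(cc)/∼`. -/
def SchurMul {C : Type u} (K : Type v) [Field K] (cc : PCategory C) :=
  Quot (FSrel (C := C) (K := K) cc)

/-- A class of `M(cc)` is idempotent if it is represented by a factor set `ρ` with
`ρ·ρ ∼ ρ` (pointwise product). -/
def IsIdemClass {C : Type u} {K : Type v} [Field K] (cc : PCategory C)
    (c : SchurMul K cc) : Prop :=
  ∃ ρ τ : FS K cc, Quot.mk (FSrel cc) ρ = c ∧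
    (∀ x y, τ.1 x y = ρ.1 x y * ρ.1 x y) ∧ Quot.mk (FSrel cc) τ = c

namespace PCategory

variable {C : Type u} {K : Type v} [Field K] (cc : PCategory C)

/-- Right translation of functions on the category, truncated along the set `I`. -/
noncomputable def truncTranslation (K : Type v) [Field K] (I : Set C) (x : C) :
    Module.End K (C → K) where
  toFun f y := if cc.comp y x ∧ cc.mul y x ∉ I then f (cc.mul y x) else 0
  map_add' f g := by
    funext y
    simp only [Pi.add_apply]
    split_ifs <;> simp
  map_smul' a f := by
    funext y
    simp

theorem truncTranslation_apply (I : Set C) (x : C) (f : C → K) (y : C) :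
    cc.truncTranslation K I x f y =
      if cc.comp y x ∧ cc.mul y x ∉ I then f (cc.mul y x) else 0 := rfl

variable {cc}

theorem comp_mul_left {x y z : C} (h : cc.comp x y) : cc.comp (cc.mul x y) z ↔ cc.comp y z := by
  rw [cc.comp_iff, cc.comp_iff, cc.src_mul x y h]

theorem comp_mul_right {x y z : C} (h : cc.comp y z) : cc.comp x (cc.mul y z) ↔ cc.comp x y := by
  rw [cc.comp_iff, cc.comp_iff, cc.tgt_mul y z h]

theorem truncTranslation_eq_zero_iff {I : Set C} (hI : cc.IsIdeal I) (x : C) :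
    cc.truncTranslation K I x = 0 ↔ x ∈ I := by
  constructor
  · intro h
    by_contra hx
    have := congrFun (LinearMap.congr_fun h (fun _ => 1)) (cc.tgt x)
    simp [truncTranslation_apply, cc.comp_tgt_self, cc.tgt_mul_self, hx] at this
  · intro hx
    ext1 f
    funext y
    rw [truncTranslation_apply, if_neg fun h => h.2 (hI _ _ h.1 (.inr hx))]
    rfl

theorem truncTranslation_mul_of_comp {I : Set C} (hI : cc.IsIdeal I) {x y : C}
    (h : cc.comp x y) :
    cc.truncTranslation K I x * cc.truncTranslation K I y =
      cc.truncTranslation K I (cc.mul x y) := by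
  ext1 f
  funext z
  simp only [Module.End.mul_apply, truncTranslation_apply, comp_mul_right h]
  by_cases hz : cc.comp z x
  · have hzx := (comp_mul_left (z := y) hz).2 h
    rw [← cc.mul_assoc' z x y hz h]
    by_cases hm : cc.mul z x ∈ I
    · simp [hm, hI _ _ hzx (.inl hm)]
    · simp [hz, hm, hzx]
  · simp [hz]

theorem truncTranslation_mul_of_not_comp (I : Set C) {x y : C} (h : ¬ cc.comp x y) :
    cc.truncTranslation K I x * cc.truncTranslation K I y = 0 := by
  ext1 f
  funext z
  simp only [Module.End.mul_apply, truncTranslation_apply]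
  by_cases hz : cc.comp z x
  · simp [comp_mul_left hz, h]
  · simp [hz]

variable (cc) in
/-- The indicator function of the composable pairs whose product lies outside `I`. -/
noncomputable def idealIndicator (K : Type v) [Field K] (I : Set C) (x y : C) : K :=
  if cc.comp x y ∧ cc.mul x y ∉ I then 1 else 0

theorem idealIndicator_ne_zero (I : Set C) (x y : C) :
    cc.idealIndicator K I x y ≠ 0 ↔ cc.comp x y ∧ cc.mul x y ∉ I := by
  simp [idealIndicator]

theorem idealIndicator_mul_self (I : Set C) (x y : C) :
    cc.idealIndicator K I x y * cc.idealIndicator K I x y = cc.idealIndicator K I x y := by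
  simp [idealIndicator]

theorem isFactorSet_idealIndicator {I : Set C} (hI : cc.IsIdeal I) :
    IsFactorSet cc (cc.idealIndicator K I) := by
  refine ⟨Module.End K (C → K), ⟨(· * ·), 0, (· • ·)⟩, ?_, ?_, cc.truncTranslation K I,
    ?_, ?_, ?_, ?_⟩
  · exact ⟨mul_assoc, zero_mul, mul_zero, smul_smul, one_smul K, smul_mul_assoc,
      mul_smul_comm, zero_smul K⟩
  · exact fun a b x hx h => smul_left_injective K hx h
  · intro x y h
    dsimp only
    rw [truncTranslation_mul_of_comp hI h]
  · exact fun x y h => truncTranslation_mul_of_not_comp I h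
  · intro x y
    rw [idealIndicator_ne_zero, Ne, truncTranslation_eq_zero_iff hI]
  · intro x y h hxy
    rw [Ne, truncTranslation_eq_zero_iff hI] at hxy
    simp only [idealIndicator, h, hxy, truncTranslation_mul_of_comp hI h]
    simp

variable (cc) in
/-- The elements at which a representation with factor set `ρ` vanishes. -/
def vanishingSet (ρ : C → C → K) : Set C := {x | ρ (cc.tgt x) x = 0}

theorem vanishingSet_idealIndicator (I : Set C) :
    cc.vanishingSet (cc.idealIndicator K I) = I := by
  ext x
  simp [vanishingSet, idealIndicator, cc.comp_tgt_self, cc.tgt_mul_self]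

theorem vanishingSet_mul {ρ₁ ρ₂ ρ₃ : C → C → K} (h : ∀ x y, ρ₃ x y = ρ₁ x y * ρ₂ x y) :
    cc.vanishingSet ρ₃ = cc.vanishingSet ρ₁ ∪ cc.vanishingSet ρ₂ := by
  ext x
  simp [vanishingSet, h]

end PCategory

section FactorSets

open PCategory

variable {C : Type u} {K : Type v} [Field K] {cc : PCategory C} {ρ : C → C → K}

theorem IsProjRep.mem_vanishingSet {S : Type w} {M : KSgStr K S} {Γ : C → S}
    (h : IsProjRep cc M Γ ρ) (x : C) : x ∈ cc.vanishingSet ρ ↔ Γ x = M.zero := by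
  have := h.2.2.1 (cc.tgt x) x
  rw [cc.tgt_mul_self, and_iff_right (cc.comp_tgt_self x)] at this
  exact not_iff_not.1 this

theorem IsFactorSet.isIdeal_vanishingSet (h : IsFactorSet cc ρ) :
    cc.IsIdeal (cc.vanishingSet ρ) := by
  obtain ⟨S, M, hM, -, Γ, hΓ⟩ := h
  intro x y hxy hI
  simp only [hΓ.mem_vanishingSet] at hI ⊢
  rw [hΓ.1 x y hxy]
  rcases hI with hx | hy
  · rw [hx, hM.2.1]
  · rw [hy, hM.2.2.1]

theorem IsFactorSet.ne_zero_iff (h : IsFactorSet cc ρ) (x y : C) :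
    ρ x y ≠ 0 ↔ cc.comp x y ∧ cc.mul x y ∉ cc.vanishingSet ρ := by
  obtain ⟨S, M, -, -, Γ, hΓ⟩ := h
  rw [hΓ.2.2.1, hΓ.mem_vanishingSet]

theorem IsFactorSet.eq_idealIndicator (h : IsFactorSet cc ρ)
    (hρ : ∀ x y, ρ x y * ρ x y = ρ x y) :
    cc.idealIndicator K (cc.vanishingSet ρ) = ρ := by
  funext x y
  by_cases h0 : ρ x y = 0
  · rw [h0]
    by_contra hne
    exact (h.ne_zero_iff x y).2 ((idealIndicator_ne_zero _ x y).1 hne) h0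
  · rw [idealIndicator, if_pos ((h.ne_zero_iff x y).1 h0)]
    exact (mul_left_cancel₀ h0 ((hρ x y).trans (mul_one _).symm)).symm

theorem IsFactorSet.eq_zero_of_not_comp (h : IsFactorSet cc ρ) {x y : C}
    (hxy : ¬ cc.comp x y) : ρ x y = 0 :=
  by_contra fun hne => hxy ((h.ne_zero_iff x y).1 hne).1

theorem FSrel.equivalence : Equivalence (FSrel (K := K) cc) where
  refl ρ := ⟨1, fun x y _ => by simp,
    fun x y h => ⟨ρ.2.eq_zero_of_not_comp h, ρ.2.eq_zero_of_not_comp h⟩⟩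
  symm := by
    rintro ρ σ ⟨ν, h, h'⟩
    refine ⟨ν⁻¹, fun x y hxy => ?_, fun x y hxy => (h' x y hxy).symm⟩
    rw [h x y hxy]
    simp only [Pi.inv_apply, Units.val_inv_eq_inv_val]
    field_simp
  trans := by
    rintro ρ σ τ ⟨ν, h, h'⟩ ⟨μ, k, k'⟩
    refine ⟨ν * μ, fun x y hxy => ?_, fun x y hxy => ⟨(h' x y hxy).1, (k' x y hxy).2⟩⟩
    rw [h x y hxy, k x y hxy]
    simp only [Pi.mul_apply, Units.val_mul]
    field_simp

theorem FSrel.vanishingSet_eq {ρ σ : FS K cc} (h : FSrel cc ρ σ) :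
    cc.vanishingSet ρ.1 = cc.vanishingSet σ.1 := by
  obtain ⟨ν, h, -⟩ := h
  ext x
  simp [vanishingSet, h _ _ (cc.comp_tgt_self x)]

theorem FSrel.idealIndicator_of_sq {ρ τ : FS K cc} (hτ : ∀ x y, τ.1 x y = ρ.1 x y * ρ.1 x y)
    (h : FSrel cc ρ τ) :
    FSrel cc ⟨_, isFactorSet_idealIndicator ρ.2.isIdeal_vanishingSet⟩ ρ := by
  obtain ⟨ν, h, -⟩ := h
  refine ⟨ν, fun x y hxy => ?_, fun x y hxy =>
    ⟨if_neg fun h => hxy h.1, ρ.2.eq_zero_of_not_comp hxy⟩⟩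
  by_cases h0 : ρ.1 x y = 0
  · rw [h0, mul_zero]
    by_contra hne
    exact (ρ.2.ne_zero_iff x y).2 ((idealIndicator_ne_zero _ x y).1 hne) h0
  · have hρ := h x y hxy
    rw [hτ, ← mul_assoc] at hρ
    exact (if_pos ((ρ.2.ne_zero_iff x y).1 h0)).trans
      (mul_right_cancel₀ h0 ((one_mul _).trans hρ))

/-- The ideal attached to a class of factor sets. -/
def SchurMul.toIdeal (c : SchurMul K cc) : IdealSub cc :=
  Quot.lift (fun ρ : FS K cc => ⟨cc.vanishingSet ρ.1, ρ.2.isIdeal_vanishingSet⟩)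
    (fun _ _ h => Subtype.ext h.vanishingSet_eq) c

/-- The factor set attached to an ideal. -/
noncomputable def IdealSub.toFS (K : Type v) [Field K] (I : IdealSub cc) : FS K cc :=
  ⟨cc.idealIndicator K I.1, isFactorSet_idealIndicator I.2⟩

theorem IsIdemClass.mk_toFS_toIdeal {c : SchurMul K cc} (hc : IsIdemClass cc c) :
    Quot.mk (FSrel cc) (c.toIdeal.toFS K) = c := by
  obtain ⟨ρ, τ, rfl, hτ, h⟩ := hc
  exact Quot.sound (FSrel.idealIndicator_of_sq hτ
    (FSrel.equivalence.eqvGen_iff.1 (Quot.eqvGen_exact h.symm)))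

/-- Idempotent factor sets correspond to ideals. -/
noncomputable def IdemFS.equivIdealSub : IdemFS K cc ≃ IdealSub cc where
  toFun ε := ⟨cc.vanishingSet ε.1, ε.2.1.isIdeal_vanishingSet⟩
  invFun I := ⟨_, isFactorSet_idealIndicator I.2, idealIndicator_mul_self I.1⟩
  left_inv ε := Subtype.ext (ε.2.1.eq_idealIndicator ε.2.2)
  right_inv I := Subtype.ext (vanishingSet_idealIndicator I.1)

/-- Idempotent classes of the Schur multiplier correspond to ideals. -/
noncomputable def SchurMul.equivIdealSub :
    {c : SchurMul K cc // IsIdemClass cc c} ≃ IdealSub cc where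
  toFun c := c.1.toIdeal
  invFun I := ⟨Quot.mk _ (I.toFS K), I.toFS K, I.toFS K, rfl,
    fun x y => (idealIndicator_mul_self I.1 x y).symm, rfl⟩
  left_inv c := Subtype.ext c.2.mk_toFS_toIdeal
  right_inv I := Subtype.ext (vanishingSet_idealIndicator I.1)

end FactorSets

/-- The semilattice `b(cc)` of idempotents of the factor-set semigroup
`m(cc)`, the semilattice `B(cc)` of idempotents of the partial Schur multiplier
`M(cc) = m(cc)/∼`, and the semilattice `Y(cc)` of ideals of `cc` under union, are pairwise
isomorphic as semilattices (the bijections turning pointwise products of factor sets into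
unions of ideals). -/
theorem statement6 {C : Type u} {K : Type v} [Field K] (cc : PCategory C) :
    (∃ f : IdemFS K cc ≃ IdealSub cc,
      ∀ ε₁ ε₂ ε₃ : IdemFS K cc, (∀ x y, ε₃.1 x y = ε₁.1 x y * ε₂.1 x y) →
        (f ε₃).1 = (f ε₁).1 ∪ (f ε₂).1) ∧
    (∃ gq : {c : SchurMul K cc // IsIdemClass cc c} ≃ IdealSub cc,
      ∀ (c₁ c₂ c₃ : {c : SchurMul K cc // IsIdemClass cc c}) (ρ₁ ρ₂ ρ₃ : FS K cc),
        Quot.mk (FSrel cc) ρ₁ = c₁.1 → Quot.mk (FSrel cc) ρ₂ = c₂.1 →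
        Quot.mk (FSrel cc) ρ₃ = c₃.1 →
        (∀ x y, ρ₃.1 x y = ρ₁.1 x y * ρ₂.1 x y) →
        (gq c₃).1 = (gq c₁).1 ∪ (gq c₂).1) := by
  refine ⟨⟨IdemFS.equivIdealSub, fun _ _ _ h => PCategory.vanishingSet_mul h⟩,
    SchurMul.equivIdealSub, ?_⟩
  rintro ⟨_, _⟩ ⟨_, _⟩ ⟨_, _⟩ ρ₁ ρ₂ ρ₃ rfl rfl rfl h
  exact PCategory.vanishingSet_mul h
end

section
/- Let 𝔠 be a category, 𝕂 a field and 𝔦 an ideal of 𝔠. The Clifford component m_𝔦(𝔠) of the factor-set semigroup m(𝔠) associated with 𝔦 (the maximal subgroup whose identity is the idempotent ε_𝔦) consists exactly of the factor sets ρ of 𝔠 satisfying: ρ(x,y) = 0 ⟺ (xy is undefined, or xy is defined and xy ∈ 𝔦). -/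
attribute [local instance] Classical.propDecidable

universe u v w

/-- The scalar multiple `a • x` in the zero-extended set of monomials, with `0 • x = none`. -/
noncomputable def monomial {C : Type u} {K : Type v} [Field K] (x : C) (a : K) :
    Option (C × Kˣ) :=
  if h : a = 0 then none else some (x, Units.mk0 a h)

theorem monomial_eq_none {C : Type u} {K : Type v} [Field K] (x : C) (a : K) :
    monomial x a = none ↔ a = 0 := by
  unfold monomial
  split_ifs with h <;> simp [h]

theorem monomial_zero {C : Type u} {K : Type v} [Field K] (x : C) :
    monomial x (0 : K) = none := (monomial_eq_none x 0).2 rfl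

theorem monomial_injective {C : Type u} {K : Type v} [Field K] (x : C) :
    Function.Injective (monomial x : K → Option (C × Kˣ)) := by
  intro a b h
  unfold monomial at h
  split_ifs at h with ha hb hb
  · rw [ha, hb]
  · simpa using congrArg (fun s => s.map (fun p => (p.2 : K))) h

theorem eq_none_or_eq_monomial {C : Type u} {K : Type v} [Field K] (s : Option (C × Kˣ)) :
    s = none ∨ ∃ x a, s = monomial x a := by
  rcases s with _ | ⟨x, a⟩
  · exact Or.inl rfl
  · exact Or.inr ⟨x, a, by simp [monomial]⟩

/-- The `σ`-twisted contracted semigroup of monomials of a category. -/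
noncomputable def twistedSemigroup {C : Type u} {K : Type v} [Field K] (cc : PCategory C)
    (σ : C → C → K) : KSgStr K (Option (C × Kˣ)) where
  mul s t := s.elim none fun p => t.elim none fun q =>
    monomial (cc.mul p.1 q.1) (p.2 * q.2 * σ p.1 q.1)
  zero := none
  smul a s := s.elim none fun p => monomial p.1 (a * p.2)

section twistedSemigroup

variable {C : Type u} {K : Type v} [Field K] (cc : PCategory C) (σ : C → C → K)

theorem twistedSemigroup_zero : (twistedSemigroup cc σ).zero = none := rfl

theorem twistedSemigroup_none_mul (s : Option (C × Kˣ)) :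
    (twistedSemigroup cc σ).mul none s = none := rfl

theorem twistedSemigroup_mul_none (s : Option (C × Kˣ)) :
    (twistedSemigroup cc σ).mul s none = none := by
  cases s <;> rfl

theorem twistedSemigroup_smul_none (a : K) :
    (twistedSemigroup cc σ).smul a none = none := rfl

theorem twistedSemigroup_mul_monomial (x y : C) (a b : K) :
    (twistedSemigroup cc σ).mul (monomial x a) (monomial y b) =
      monomial (cc.mul x y) (a * b * σ x y) := by
  by_cases ha : a = 0
  · simp [ha, monomial_zero, twistedSemigroup_none_mul]
  by_cases hb : b = 0
  · simp [hb, monomial_zero, twistedSemigroup_mul_none]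
  rw [monomial, dif_neg ha, monomial, dif_neg hb]
  rfl

theorem twistedSemigroup_smul_monomial (x : C) (a b : K) :
    (twistedSemigroup cc σ).smul a (monomial x b) = monomial x (a * b) := by
  by_cases hb : b = 0
  · simp [hb, monomial_zero, twistedSemigroup_smul_none]
  rw [monomial, dif_neg hb]
  rfl

theorem twistedSemigroup_isKCancellative : (twistedSemigroup cc σ).IsKCancellative := by
  intro a b s hs h
  obtain rfl | ⟨x, c, rfl⟩ := eq_none_or_eq_monomial s
  · exact absurd rfl hs
  · rw [twistedSemigroup_smul_monomial, twistedSemigroup_smul_monomial] at h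
    exact mul_right_cancel₀ (fun hc => hs ((monomial_eq_none x c).2 hc))
      (monomial_injective x h)

variable {σ}

theorem twistedSemigroup_isKSemigroup
    (hcomp : ∀ x y, σ x y ≠ 0 → cc.comp x y)
    (hcocycle : ∀ x y z, σ x y * σ (cc.mul x y) z = σ y z * σ x (cc.mul y z)) :
    (twistedSemigroup cc σ).IsKSemigroup := by
  refine ⟨?_, twistedSemigroup_none_mul cc σ, twistedSemigroup_mul_none cc σ,
    ?_, ?_, ?_, ?_, ?_⟩
  · intro s t r
    obtain rfl | ⟨x, a, rfl⟩ := eq_none_or_eq_monomial s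
    · simp only [twistedSemigroup_none_mul]
    obtain rfl | ⟨y, b, rfl⟩ := eq_none_or_eq_monomial t
    · simp only [twistedSemigroup_none_mul, twistedSemigroup_mul_none]
    obtain rfl | ⟨z, c, rfl⟩ := eq_none_or_eq_monomial r
    · simp only [twistedSemigroup_mul_none]
    simp only [twistedSemigroup_mul_monomial]
    have hcoef : a * b * σ x y * c * σ (cc.mul x y) z =
        a * (b * c * σ y z) * σ x (cc.mul y z) := by
      linear_combination a * b * c * hcocycle x y z
    rw [hcoef]
    by_cases h : σ x y * σ (cc.mul x y) z = 0
    · have h0 : a * (b * c * σ y z) * σ x (cc.mul y z) = 0 := by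
        rw [← hcoef]
        linear_combination a * b * c * h
      rw [h0, monomial_zero, monomial_zero]
    · have hxy := hcomp _ _ (left_ne_zero_of_mul h)
      rw [hcocycle] at h
      rw [cc.mul_assoc' x y z hxy (hcomp _ _ (left_ne_zero_of_mul h))]
  · intro a b s
    obtain rfl | ⟨x, c, rfl⟩ := eq_none_or_eq_monomial s
    · simp only [twistedSemigroup_smul_none]
    · simp only [twistedSemigroup_smul_monomial, mul_assoc]
  · intro s
    obtain rfl | ⟨x, c, rfl⟩ := eq_none_or_eq_monomial s
    · simp only [twistedSemigroup_smul_none]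
    · simp only [twistedSemigroup_smul_monomial, one_mul]
  · intro a s t
    obtain rfl | ⟨x, b, rfl⟩ := eq_none_or_eq_monomial s
    · simp only [twistedSemigroup_smul_none, twistedSemigroup_none_mul]
    obtain rfl | ⟨y, c, rfl⟩ := eq_none_or_eq_monomial t
    · simp only [twistedSemigroup_smul_none, twistedSemigroup_mul_none]
    simp only [twistedSemigroup_mul_monomial, twistedSemigroup_smul_monomial, mul_assoc]
  · intro a s t
    obtain rfl | ⟨x, b, rfl⟩ := eq_none_or_eq_monomial s
    · simp only [twistedSemigroup_smul_none, twistedSemigroup_none_mul]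
    obtain rfl | ⟨y, c, rfl⟩ := eq_none_or_eq_monomial t
    · simp only [twistedSemigroup_smul_none, twistedSemigroup_mul_none]
    simp only [twistedSemigroup_mul_monomial, twistedSemigroup_smul_monomial, mul_assoc,
      mul_left_comm b a]
  · intro s
    obtain rfl | ⟨x, c, rfl⟩ := eq_none_or_eq_monomial s
    · rfl
    · rw [twistedSemigroup_smul_monomial, zero_mul, monomial_zero, twistedSemigroup_zero]

/-- A cocycle supported exactly on the composable pairs with product outside an ideal is a
factor set. -/
theorem isFactorSet_of_cocycle {I : Set C} (hI : cc.IsIdeal I)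
    (hsupp : ∀ x y, σ x y ≠ 0 ↔ cc.comp x y ∧ cc.mul x y ∉ I)
    (hcocycle : ∀ x y z, σ x y * σ (cc.mul x y) z = σ y z * σ x (cc.mul y z)) :
    IsFactorSet cc σ := by
  have hzero : ∀ x, monomial x (if x ∈ I then (0 : K) else 1) = none ↔ x ∈ I := by
    intro x
    rw [monomial_eq_none]
    split_ifs with h <;> simp [h]
  have hmul : ∀ x y, (twistedSemigroup cc σ).mul
      (monomial x (if x ∈ I then (0 : K) else 1)) (monomial y (if y ∈ I then (0 : K) else 1)) =
      monomial (cc.mul x y) (σ x y) := by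
    intro x y
    rw [twistedSemigroup_mul_monomial]
    by_cases h : σ x y = 0
    · rw [h, mul_zero]
    · obtain ⟨hxy, hn⟩ := (hsupp x y).1 h
      rw [if_neg fun hx => hn (hI x y hxy (Or.inl hx)),
        if_neg fun hy => hn (hI x y hxy (Or.inr hy)), one_mul, one_mul]
  refine ⟨Option (C × Kˣ), twistedSemigroup cc σ,
    twistedSemigroup_isKSemigroup cc (fun x y h => ((hsupp x y).1 h).1) hcocycle,
    twistedSemigroup_isKCancellative cc σ,
    fun x => monomial x (if x ∈ I then (0 : K) else 1), ?_, ?_, ?_, ?_⟩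
  · intro x y hxy
    rw [twistedSemigroup_zero, hzero, hmul, monomial_eq_none]
    have := hsupp x y
    tauto
  · intro x y hxy
    rw [twistedSemigroup_zero, hmul, monomial_eq_none]
    have := hsupp x y
    tauto
  · intro x y
    rw [twistedSemigroup_zero, Ne.eq_def (monomial _ _), hzero]
    exact hsupp x y
  · intro x y hxy hn
    rw [twistedSemigroup_zero, Ne.eq_def, hzero] at hn
    beta_reduce
    rw [hmul, if_neg hn, twistedSemigroup_smul_monomial, mul_one]

/-- A factor set supported exactly on the composable pairs with product outside an ideal
satisfies the cocycle identity for all triples. -/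
theorem IsFactorSet.cocycle {ρ : C → C → K} (hρ : IsFactorSet cc ρ) {I : Set C}
    (hI : cc.IsIdeal I)
    (hsupp : ∀ x y, ρ x y ≠ 0 ↔ cc.comp x y ∧ cc.mul x y ∉ I) (x y z : C) :
    ρ x y * ρ (cc.mul x y) z = ρ y z * ρ x (cc.mul y z) := by
  have hleft : ∀ {x y z}, cc.comp x y → (cc.comp (cc.mul x y) z ↔ cc.comp y z) := by
    intro x y z h
    rw [cc.comp_iff, cc.comp_iff, cc.src_mul x y h]
  have hright : ∀ {x y z}, cc.comp y z → (cc.comp x (cc.mul y z) ↔ cc.comp x y) := by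
    intro x y z h
    rw [cc.comp_iff, cc.comp_iff, cc.tgt_mul y z h]
  by_cases h : cc.comp x y ∧ cc.comp y z ∧ cc.mul (cc.mul x y) z ∉ I
  · obtain ⟨hxy, hyz, hn⟩ := h
    have hassoc := cc.mul_assoc' x y z hxy hyz
    have hxy_z := (hleft (z := z) hxy).2 hyz
    have hx_yz := (hright (x := x) hyz).2 hxy
    have hnxy : cc.mul x y ∉ I := fun h => hn (hI _ _ hxy_z (Or.inl h))
    have hnyz : cc.mul y z ∉ I := fun h => hn (hassoc ▸ hI _ _ hx_yz (Or.inr h))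
    obtain ⟨S, M, ⟨massoc, -, -, msmul, -, smulmul, mulsmul, -⟩, hcan, Γ, -, -, hne, hΓ⟩ := hρ
    have key : ∀ {a b}, cc.comp a b → cc.mul a b ∉ I → Γ (cc.mul a b) ≠ M.zero :=
      fun hab hnab => ((hne _ _).1 ((hsupp _ _).2 ⟨hab, hnab⟩)).2
    refine hcan _ _ _ (key hxy_z hn) ?_
    have h1 := massoc (Γ x) (Γ y) (Γ z)
    rw [hΓ x y hxy (key hxy hnxy), hΓ y z hyz (key hyz hnyz), smulmul, mulsmul,
      hΓ _ _ hxy_z (key hxy_z hn), hΓ _ _ hx_yz (key hx_yz (hassoc ▸ hn)), msmul, msmul,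
      ← hassoc] at h1
    exact h1
  · trans 0
    · by_contra h0
      obtain ⟨hxy, -⟩ := (hsupp _ _).1 (left_ne_zero_of_mul h0)
      obtain ⟨hxy_z, hn⟩ := (hsupp _ _).1 (right_ne_zero_of_mul h0)
      exact h ⟨hxy, (hleft hxy).1 hxy_z, hn⟩
    · by_contra h0
      obtain ⟨hyz, -⟩ := (hsupp _ _).1 (left_ne_zero_of_mul (Ne.symm h0))
      obtain ⟨hx_yz, hn⟩ := (hsupp _ _).1 (right_ne_zero_of_mul (Ne.symm h0))
      have hxy := (hright hyz).1 hx_yz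
      exact h ⟨hxy, hyz, (cc.mul_assoc' x y z hxy hyz).symm ▸ hn⟩

end twistedSemigroup

/-- Let `I` be an ideal of the category `cc` and `ε = ε_I` the associated
idempotent factor set (`ε(x,y) = 0` iff `xy` is undefined or `xy ∈ I`).  The Clifford
component `m_I(cc)` — the maximal subgroup of `m(cc)` with identity `ε_I`, i.e. the factor
sets `ρ` with `ρ·ε = ρ` admitting an inverse `τ` relative to `ε` — consists exactly of the
factor sets `ρ` with `ρ(x,y) = 0 ⟺ (xy` undefined, or `xy` defined and `xy ∈ I)`. -/
theorem statement7 {C : Type u} {K : Type v} [Field K] (cc : PCategory C)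
    (I : Set C) (hI : cc.IsIdeal I)
    (ε : C → C → K)
    (hε : ∀ x y, ((cc.comp x y ∧ cc.mul x y ∉ I) → ε x y = 1) ∧
                 (¬(cc.comp x y ∧ cc.mul x y ∉ I) → ε x y = 0))
    (ρ : C → C → K) (hρ : IsFactorSet cc ρ) :
    ((∀ x y, ρ x y * ε x y = ρ x y) ∧
      ∃ τ : C → C → K, IsFactorSet cc τ ∧ (∀ x y, τ x y * ε x y = τ x y) ∧
        (∀ x y, ρ x y * τ x y = ε x y)) ↔
    (∀ x y, ρ x y = 0 ↔ (¬ cc.comp x y ∨ (cc.comp x y ∧ cc.mul x y ∈ I))) := by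
  constructor
  · rintro ⟨hρε, τ, -, -, hρτ⟩ x y
    by_cases h : cc.comp x y ∧ cc.mul x y ∉ I
    · have hne : ρ x y ≠ 0 := by
        intro h0
        have := hρτ x y
        rw [h0, zero_mul, (hε x y).1 h] at this
        exact zero_ne_one this
      tauto
    · have h0 : ρ x y = 0 := by
        rw [← hρε x y, (hε x y).2 h, mul_zero]
      tauto
  · intro hzero
    have hsupp : ∀ x y, ρ x y ≠ 0 ↔ cc.comp x y ∧ cc.mul x y ∉ I := by
      intro x y
      have := hzero x y
      tauto
    have hcocycle := hρ.cocycle cc hI hsupp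
    have hε_one : ∀ x y, ρ x y ≠ 0 → ε x y = 1 := fun x y h =>
      (hε x y).1 ((hsupp x y).1 h)
    have hε_zero : ∀ x y, ρ x y = 0 → ε x y = 0 := fun x y h =>
      (hε x y).2 fun h' => (hsupp x y).2 h' h
    refine ⟨fun x y => ?_, fun x y => (ρ x y)⁻¹, ?_, fun x y => ?_, fun x y => ?_⟩
    · by_cases h : ρ x y = 0
      · rw [h, zero_mul]
      · rw [hε_one x y h, mul_one]
    · refine isFactorSet_of_cocycle cc hI (fun x y => ?_) fun x y z => ?_
      · rw [← hsupp, ne_eq, inv_eq_zero]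
      · rw [← mul_inv, ← mul_inv, hcocycle]
    · by_cases h : ρ x y = 0
      · simp only [h, inv_zero, zero_mul]
      · rw [hε_one x y h, mul_one]
    · by_cases h : ρ x y = 0
      · rw [h, zero_mul, hε_zero x y h]
      · rw [hε_one x y h, mul_inv_cancel₀ h]
end
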